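/- arXiv:2407.11430 — 7 statements merged into one kernel-verified Lean document; each statement's English description precedes it below -/
import Mathlib

section
/- Let N ≥ 2, M ≥ 1 be integers. Every element of S_{2,1} lifts to SL₂(ℤ): if a, b ∈ ℤ/N and c, d ∈ ℤ/MN are such that (a, c) and (b, d) generate ℤ/N × ℤ/MN and ad − bc ≡ 1 (mod N), then there exists a matrix γ = (ā b̄; c̄ d̄) ∈ SL₂(ℤ) with ā ≡ a (mod N), b̄ ≡ b (mod N), c̄ ≡ c (mod MN), d̄ ≡ d (mod MN). -/
/-- The set of `n`-tuples of elements of `A` which generate `A`. -/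
def GenTuple (n : ℕ) (A : Type) [AddCommGroup A] : Type :=
  {b : Fin n → A // AddSubgroup.closure (Set.range b) = ⊤}

/-- The determinant (mod `N`) of a pair of characters of `ℤ/N × ℤ/MN`:
for `β = ((a₁,b₁),(a₂,b₂))` it is `a₁b₂ - a₂b₁ ∈ ℤ/N`. -/
def detp (N M : ℕ) (β : GenTuple 2 (ZMod N × ZMod (M*N))) : ZMod N :=
  (β.1 0).1 * ZMod.castHom (dvd_mul_left N M) (ZMod N) (β.1 1).2
    - (β.1 1).1 * ZMod.castHom (dvd_mul_left N M) (ZMod N) (β.1 0).2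

/-- If `c, d, n` are jointly coprime and `c ≠ 0`, then some translate of `d` by a multiple of `n`
is coprime to `c`. -/
theorem exists_isCoprime_add_mul {c d n m k l : ℤ} (hc : c ≠ 0)
    (h : m * c + k * d + l * n = 1) : ∃ t : ℤ, IsCoprime c (d + t * n) := by
  have hg : (Int.gcd c n : ℕ) ∣ c.natAbs := Int.natCast_dvd.1 (Int.gcd_dvd_left c n)
  have hdg : IsCoprime d (Int.gcd c n : ℤ) := by
    obtain ⟨x, hx⟩ := Int.gcd_dvd_left c n
    obtain ⟨y, hy⟩ := Int.gcd_dvd_right c n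
    exact ⟨k, m * x + l * y, by linear_combination h - m * hx - l * hy⟩
  have : NeZero c.natAbs := ⟨Int.natAbs_ne_zero.2 hc⟩
  obtain ⟨u, hu⟩ := ZMod.unitsMap_surjective hg ((ZMod.coe_int_isUnit_iff_isCoprime d _).2
    hdg.symm).unit
  obtain ⟨v, hv⟩ := ZMod.intCast_surjective (u : ZMod c.natAbs)
  have hvc : IsCoprime c v := by
    have hv' : IsCoprime (c.natAbs : ℤ) v :=
      (ZMod.coe_int_isUnit_iff_isCoprime v _).1 (hv ▸ u.isUnit)
    rwa [Int.isCoprime_iff_gcd_eq_one, Int.gcd, Int.natAbs_natCast, ← Int.gcd,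
      ← Int.isCoprime_iff_gcd_eq_one] at hv'
  have hvd : ((v : ℤ) : ZMod (Int.gcd c n)) = d := by
    have := congrArg Units.val hu
    rw [ZMod.unitsMap_val, ← hv] at this
    simpa [ZMod.cast_intCast hg] using this
  obtain ⟨w, hw⟩ := (ZMod.intCast_eq_intCast_iff_dvd_sub _ _ _).1 hvd
  have hbez := Int.gcd_eq_gcd_ab c n
  refine ⟨-(Int.gcdB c n * w), ?_⟩
  have : d + -(Int.gcdB c n * w) * n = v + c * (Int.gcdA c n * w) := by
    linear_combination hw + w * hbez
  rw [this]
  exact hvc.add_mul_left_right _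

/-- A pair in `ZMod n` generating the unit ideal lifts to a coprime pair of integers. -/
theorem exists_isCoprime_lift {n : ℕ} [NeZero n] {c d x y : ZMod n} (h : x * c + y * d = 1) :
    ∃ c' d' : ℤ, IsCoprime c' d' ∧ (c' : ZMod n) = c ∧ (d' : ZMod n) = d := by
  have hlift : ∃ c' : ℤ, c' ≠ 0 ∧ (c' : ZMod n) = c := by
    obtain ⟨c₀, rfl⟩ := ZMod.intCast_surjective c
    by_cases hc : c₀ = 0
    · exact ⟨n, by exact_mod_cast NeZero.ne n, by simp [hc]⟩
    · exact ⟨c₀, hc, rfl⟩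
  obtain ⟨c', hc, rfl⟩ := hlift
  obtain ⟨d, rfl⟩ := ZMod.intCast_surjective d
  obtain ⟨x, rfl⟩ := ZMod.intCast_surjective x
  obtain ⟨y, rfl⟩ := ZMod.intCast_surjective y
  have hxy : ((x * c' + y * d : ℤ) : ZMod n) = (1 : ℤ) := by exact_mod_cast h
  obtain ⟨l, hl⟩ := (ZMod.intCast_eq_intCast_iff_dvd_sub _ _ _).1 hxy
  obtain ⟨t, ht⟩ := exists_isCoprime_add_mul hc
    (show x * c' + y * d + l * (n : ℤ) = 1 by linear_combination -hl)
  exact ⟨c', d + t * n, ht, rfl, by simp⟩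

theorem statement_4 (N M : ℕ) (hN : 2 ≤ N) (hM : 1 ≤ M)
    (a b : ZMod N) (c d : ZMod (M*N))
    (hgen : AddSubgroup.closure
      (Set.range ![((a, c) : ZMod N × ZMod (M*N)), ((b, d) : ZMod N × ZMod (M*N))]) = ⊤)
    (hdet : a * ZMod.castHom (dvd_mul_left N M) (ZMod N) d
      - b * ZMod.castHom (dvd_mul_left N M) (ZMod N) c = 1) :
    ∃ γ : Matrix.SpecialLinearGroup (Fin 2) ℤ,
      ((γ.1 0 0 : ℤ) : ZMod N) = a ∧ ((γ.1 0 1 : ℤ) : ZMod N) = b ∧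
      ((γ.1 1 0 : ℤ) : ZMod (M*N)) = c ∧ ((γ.1 1 1 : ℤ) : ZMod (M*N)) = d := by
  have : NeZero (M * N) := ⟨by positivity⟩
  have hmem : ((0, 1) : ZMod N × ZMod (M*N)) ∈ AddSubgroup.closure
      (Set.range ![((a, c) : ZMod N × ZMod (M*N)), ((b, d) : ZMod N × ZMod (M*N))]) :=
    hgen ▸ AddSubgroup.mem_top _
  rw [Matrix.range_cons_cons_empty, AddSubgroup.mem_closure_pair] at hmem
  obtain ⟨x, y, hxy⟩ := hmem
  have hcd : (x : ZMod (M*N)) * c + (y : ZMod (M*N)) * d = 1 := by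
    simpa [zsmul_eq_mul] using congrArg Prod.snd hxy
  obtain ⟨c, d, ⟨p, q, hpq⟩, rfl, rfl⟩ := exists_isCoprime_lift hcd
  obtain ⟨a, rfl⟩ := ZMod.intCast_surjective a
  obtain ⟨b, rfl⟩ := ZMod.intCast_surjective b
  have hdet' : ((1 : ℤ) : ZMod N) = (a * d - b * c : ℤ) := by
    simpa using hdet.symm
  obtain ⟨k, hk⟩ := (ZMod.intCast_eq_intCast_iff_dvd_sub _ _ _).1 hdet'
  refine ⟨⟨!![a - N * k * q, b + N * k * p; c, d], ?_⟩, ?_⟩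
  · rw [Matrix.det_fin_two_of]
    linear_combination hk - N * k * hpq
  · simp
end

section
/- Let N ≥ 2, M ≥ 1 be integers and k ∈ (ℤ/N)ˣ. The map ⟨(a₁,b₁),(a₂,b₂)⟩⁻ ↦ ⟨(k·a₁, b₁),(k·a₂, b₂)⟩⁻ defines a group homomorphism M_{2,1}⁻ → M_{2,k}⁻, the map ⟨(a₁,b₁),(a₂,b₂)⟩⁻ ↦ ⟨(k⁻¹·a₁, b₁),(k⁻¹·a₂, b₂)⟩⁻ defines a group homomorphism M_{2,k}⁻ → M_{2,1}⁻, and these two homomorphisms are mutually inverse; in particular M_{2,k}⁻ ≅ M_{2,1}⁻ as abelian groups. -/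
open FreeAbelianGroup

namespace KPT2

variable (N M : ℕ)

/-- The set `S_{2,k} ∪ S_{2,-k}`: generating pairs of `ℤ/N × ℤ/MN` with
determinant `± k`. -/
def Tk (k : (ZMod N)ˣ) : Type :=
  {β : GenTuple 2 (ZMod N × ZMod (M*N)) //
    detp N M β = (k : ZMod N) ∨ detp N M β = -(k : ZMod N)}

/-- The reordering relation (O) on symbols of determinant `±k`. -/
def relOk (k : (ZMod N)ˣ) : Set (FreeAbelianGroup (Tk N M k)) :=
  {x | ∃ β β' : Tk N M k,
    β'.1.1 0 = β.1.1 1 ∧ β'.1.1 1 = β.1.1 0 ∧ x = of β - of β'}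

/-- The motivic blowup relation (M) on symbols of determinant `±k`. -/
def relMk (k : (ZMod N)ˣ) : Set (FreeAbelianGroup (Tk N M k)) :=
  {x | ∃ β β₁ β₂ : Tk N M k,
    β₁.1.1 0 = β.1.1 0 - β.1.1 1 ∧ β₁.1.1 1 = β.1.1 1 ∧
    β₂.1.1 0 = β.1.1 0 ∧ β₂.1.1 1 = β.1.1 1 - β.1.1 0 ∧
    x = of β - of β₁ - of β₂}

/-- The anti-symmetry relation (A) on symbols of determinant `±k`. -/
def relAk (k : (ZMod N)ˣ) : Set (FreeAbelianGroup (Tk N M k)) :=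
  {x | ∃ β β' : Tk N M k,
    β'.1.1 0 = -β.1.1 0 ∧ β'.1.1 1 = β.1.1 1 ∧ x = of β + of β'}

/-- The group `M⁻_{2,k}(ℤ/N × ℤ/MN)`. -/
def M2kMinus (k : (ZMod N)ˣ) : Type :=
  FreeAbelianGroup (Tk N M k) ⧸
    AddSubgroup.closure (relOk N M k ∪ relMk N M k ∪ relAk N M k)

instance (k : (ZMod N)ˣ) : AddCommGroup (M2kMinus N M k) :=
  QuotientAddGroup.Quotient.addCommGroup _

/-- The symbol `⟨(a₁,b₁),(a₂,b₂)⟩⁻ ∈ M⁻_{2,k}`. -/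
def symb2k (k : (ZMod N)ˣ) (β : Tk N M k) : M2kMinus N M k :=
  QuotientAddGroup.mk (of β)

end KPT2

namespace KPT2

variable {N M : ℕ}

/-- The automorphism `(a, b) ↦ (u·a, b)` of `ℤ/N × ℤ/MN`. -/
def scaleFst (M : ℕ) (u : (ZMod N)ˣ) :
    (ZMod N × ZMod (M*N)) ≃+ (ZMod N × ZMod (M*N)) :=
  AddEquiv.prodCongr (DistribMulAction.toAddEquiv (ZMod N) u) (AddEquiv.refl _)

theorem scaleFst_fst (u : (ZMod N)ˣ) (x : ZMod N × ZMod (M*N)) :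
    (scaleFst M u x).1 = (u : ZMod N) * x.1 := rfl

theorem scaleFst_snd (u : (ZMod N)ˣ) (x : ZMod N × ZMod (M*N)) :
    (scaleFst M u x).2 = x.2 := rfl

theorem closure_range_comp_addEquiv {ι A : Type} [AddCommGroup A] (e : A ≃+ A) {b : ι → A}
    (hb : AddSubgroup.closure (Set.range b) = ⊤) :
    AddSubgroup.closure (Set.range (e ∘ b)) = ⊤ := by
  have h := AddMonoidHom.map_closure e.toAddMonoidHom (Set.range b)
  rw [hb, AddSubgroup.map_top_of_surjective _ e.surjective, ← Set.range_comp] at h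
  exact h.symm

/-- The image of a generating tuple under an automorphism. -/
def GenTuple.map {n : ℕ} {A : Type} [AddCommGroup A] (e : A ≃+ A) (β : GenTuple n A) :
    GenTuple n A :=
  ⟨e ∘ β.1, closure_range_comp_addEquiv e β.2⟩

theorem detp_map_scaleFst (u : (ZMod N)ˣ) (β : GenTuple 2 (ZMod N × ZMod (M*N))) :
    detp N M (GenTuple.map (scaleFst M u) β) = (u : ZMod N) * detp N M β := by
  simp only [detp, GenTuple.map, Function.comp_apply, scaleFst_fst, scaleFst_snd]
  ring

/-- Scaling the first coordinates by `u` carries determinant `±k` to determinant `±uk`. -/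
def Tk.scale {k l : (ZMod N)ˣ} (u : (ZMod N)ˣ) (h : u * k = l) (β : Tk N M k) : Tk N M l :=
  ⟨GenTuple.map (scaleFst M u) β.1, by
    subst h
    rw [detp_map_scaleFst, Units.val_mul]
    exact β.2.imp (fun h => by rw [h]) (fun h => by rw [h, mul_neg])⟩

theorem Tk.scale_apply {k l : (ZMod N)ˣ} (u : (ZMod N)ˣ) (h : u * k = l) (β : Tk N M k)
    (i : Fin 2) : (β.scale u h).1.1 i = scaleFst M u (β.1.1 i) := rfl

theorem Tk.ext {k : (ZMod N)ˣ} {β β' : Tk N M k} (h₀ : β.1.1 0 = β'.1.1 0)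
    (h₁ : β.1.1 1 = β'.1.1 1) : β = β' := by
  refine Subtype.ext (Subtype.ext (funext fun i => ?_))
  fin_cases i
  · exact h₀
  · exact h₁

theorem Tk.scale_eq {k l : (ZMod N)ˣ} (u : (ZMod N)ˣ) (h : u * k = l) {β : Tk N M k}
    {β' : Tk N M l}
    (h₀ : (β'.1.1 0).1 = (u : ZMod N) * (β.1.1 0).1) (h₀' : (β'.1.1 0).2 = (β.1.1 0).2)
    (h₁ : (β'.1.1 1).1 = (u : ZMod N) * (β.1.1 1).1) (h₁' : (β'.1.1 1).2 = (β.1.1 1).2) :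
    β.scale u h = β' :=
  Tk.ext (Prod.ext h₀.symm h₀'.symm) (Prod.ext h₁.symm h₁'.symm)

theorem Tk.scale_scale {k l : (ZMod N)ˣ} (u v : (ZMod N)ˣ) (h : u * k = l) (h' : v * l = k)
    (huv : v * u = 1) (β : Tk N M k) : (β.scale u h).scale v h' = β := by
  have key (x : ZMod N) : x = (v : ZMod N) * ((u : ZMod N) * x) := by
    rw [← mul_assoc, ← Units.val_mul, huv, Units.val_one, one_mul]
  exact Tk.scale_eq v h' (key _) rfl (key _) rfl

/-- The relations defining `M⁻_{2,k}` are preserved by scaling the first coordinates. -/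
theorem closure_rel_le_comap_scale {k l : (ZMod N)ˣ} (u : (ZMod N)ˣ) (h : u * k = l) :
    AddSubgroup.closure (relOk N M k ∪ relMk N M k ∪ relAk N M k) ≤
      (AddSubgroup.closure (relOk N M l ∪ relMk N M l ∪ relAk N M l)).comap
        (FreeAbelianGroup.map (Tk.scale u h)) := by
  rw [AddSubgroup.closure_le]
  rintro x ((⟨β, β', h₀, h₁, rfl⟩ | ⟨β, β₁, β₂, h₁, h₂, h₃, h₄, rfl⟩) | ⟨β, β', h₀, h₁, rfl⟩) <;>
    refine AddSubgroup.subset_closure ?_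
  · refine Or.inl (Or.inl ⟨β.scale u h, β'.scale u h, ?_, ?_, ?_⟩) <;>
      simp [Tk.scale_apply, *]
  · refine Or.inl (Or.inr ⟨β.scale u h, β₁.scale u h, β₂.scale u h, ?_, ?_, ?_, ?_, ?_⟩) <;>
      simp [Tk.scale_apply, *]
  · refine Or.inr ⟨β.scale u h, β'.scale u h, ?_, ?_, ?_⟩ <;>
      simp [Tk.scale_apply, *]

/-- The homomorphism `M⁻_{2,k} → M⁻_{2,uk}` which scales the first coordinates by `u`. -/
def M2kMinus.scale {k l : (ZMod N)ˣ} (u : (ZMod N)ˣ) (h : u * k = l) :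
    M2kMinus N M k →+ M2kMinus N M l :=
  QuotientAddGroup.map _ _ (FreeAbelianGroup.map (Tk.scale u h))
    (closure_rel_le_comap_scale u h)

theorem M2kMinus.scale_symb2k {k l : (ZMod N)ˣ} (u : (ZMod N)ˣ) (h : u * k = l)
    (β : Tk N M k) :
    M2kMinus.scale u h (symb2k N M k β) = symb2k N M l (β.scale u h) :=
  congrArg QuotientAddGroup.mk (FreeAbelianGroup.map_of_apply β)

theorem M2kMinus.hom_ext {k : (ZMod N)ˣ} {G : Type} [AddCommGroup G]
    {f g : M2kMinus N M k →+ G}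
    (h : ∀ β, f (symb2k N M k β) = g (symb2k N M k β)) : f = g :=
  QuotientAddGroup.addMonoidHom_ext _ (FreeAbelianGroup.lift_ext _ _ h)

theorem M2kMinus.scale_comp_scale {k l : (ZMod N)ˣ} (u v : (ZMod N)ˣ) (h : u * k = l)
    (h' : v * l = k) (huv : v * u = 1) :
    (M2kMinus.scale v h').comp (M2kMinus.scale (M := M) u h) = AddMonoidHom.id _ :=
  M2kMinus.hom_ext fun β => by
    rw [AddMonoidHom.comp_apply, scale_symb2k, scale_symb2k, Tk.scale_scale u v h h' huv,
      AddMonoidHom.id_apply]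

end KPT2

open KPT2 FreeAbelianGroup in
theorem statement_6 (N M : ℕ) (hN : 2 ≤ N) (hM : 1 ≤ M) (k : (ZMod N)ˣ) :
    ∃ (f : M2kMinus N M 1 →+ M2kMinus N M k)
      (g : M2kMinus N M k →+ M2kMinus N M 1),
      -- `f⟨(a₁,b₁),(a₂,b₂)⟩⁻ = ⟨(k·a₁,b₁),(k·a₂,b₂)⟩⁻`
      (∀ (β : Tk N M 1) (β' : Tk N M k),
        (β'.1.1 0).1 = (k : ZMod N) * (β.1.1 0).1 → (β'.1.1 0).2 = (β.1.1 0).2 →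
        (β'.1.1 1).1 = (k : ZMod N) * (β.1.1 1).1 → (β'.1.1 1).2 = (β.1.1 1).2 →
        f (symb2k N M 1 β) = symb2k N M k β') ∧
      -- `g⟨(a₁,b₁),(a₂,b₂)⟩⁻ = ⟨(k⁻¹·a₁,b₁),(k⁻¹·a₂,b₂)⟩⁻`
      (∀ (β : Tk N M k) (β' : Tk N M 1),
        (β'.1.1 0).1 = ((k⁻¹ : (ZMod N)ˣ) : ZMod N) * (β.1.1 0).1 →
        (β'.1.1 0).2 = (β.1.1 0).2 →
        (β'.1.1 1).1 = ((k⁻¹ : (ZMod N)ˣ) : ZMod N) * (β.1.1 1).1 →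
        (β'.1.1 1).2 = (β.1.1 1).2 →
        g (symb2k N M k β) = symb2k N M 1 β') ∧
      g.comp f = AddMonoidHom.id _ ∧
      f.comp g = AddMonoidHom.id _ ∧
      Nonempty (M2kMinus N M k ≃+ M2kMinus N M 1) := by
  have hgf := M2kMinus.scale_comp_scale (M := M) k k⁻¹ (mul_one k) (inv_mul_cancel k)
    (inv_mul_cancel k)
  have hfg := M2kMinus.scale_comp_scale (M := M) k⁻¹ k (inv_mul_cancel k) (mul_one k)
    (mul_inv_cancel k)
  refine ⟨M2kMinus.scale k (mul_one k), M2kMinus.scale k⁻¹ (inv_mul_cancel k), ?_, ?_, hgf, hfg,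
    ⟨AddMonoidHom.toAddEquiv _ _ hfg hgf⟩⟩
  · intro β β' h₀ h₀' h₁ h₁'
    rw [M2kMinus.scale_symb2k, Tk.scale_eq k _ h₀ h₀' h₁ h₁']
  · intro β β' h₀ h₀' h₁ h₁'
    rw [M2kMinus.scale_symb2k, Tk.scale_eq k⁻¹ _ h₀ h₀' h₁ h₁']
end

section
/- Let M ≥ 1 be an integer and let (a, c) and (a', c') be coprime pairs of integers. The points a/c and a'/c' of ℙ¹(ℚ) lie in the same orbit under the Möbius action of Γ(2, 2M) if and only if there exist j ∈ ℤ and a sign ε ∈ {±1} such that a' ≡ ε(a + 2jc) (mod 2M) and c' ≡ εc (mod 2M). -/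
open Matrix

/-- Reduction of an integer congruence modulo `M*N` to one modulo `N`. -/
lemma castDown {N M : ℕ} {x y : ℤ} (h : (x : ZMod (M*N)) = (y : ZMod (M*N))) :
    (x : ZMod N) = (y : ZMod N) := by
  rw [ZMod.intCast_eq_intCast_iff] at h ⊢
  exact h.of_dvd (Int.natCast_dvd_natCast.2 (dvd_mul_left N M))

/-- The congruence subgroup `Γ(N, MN)` of `SL₂(ℤ)`: matrices `(a b; c d)` with
`a ≡ 1, b ≡ 0 (mod N)` and `c ≡ 0, d ≡ 1 (mod MN)`. -/
def GammaNM (N M : ℕ) : Subgroup (Matrix.SpecialLinearGroup (Fin 2) ℤ) where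
  carrier := {γ | ((γ.1 0 0 : ℤ) : ZMod N) = 1 ∧ ((γ.1 0 1 : ℤ) : ZMod N) = 0 ∧
    ((γ.1 1 0 : ℤ) : ZMod (M*N)) = 0 ∧ ((γ.1 1 1 : ℤ) : ZMod (M*N)) = 1}
  one_mem' := by
    refine ⟨?_, ?_, ?_, ?_⟩ <;>
      simp [Matrix.SpecialLinearGroup.coe_one, Matrix.one_apply]
  mul_mem' := by
    rintro a b ⟨ha1, ha2, ha3, ha4⟩ ⟨hb1, hb2, hb3, hb4⟩
    have hmul : ∀ i j, ((a*b).1 : Matrix (Fin 2) (Fin 2) ℤ) i j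
        = a.1 i 0 * b.1 0 j + a.1 i 1 * b.1 1 j := by
      intro i j
      rw [Matrix.SpecialLinearGroup.coe_mul, Matrix.mul_apply, Fin.sum_univ_two]
    have hb3N : ((b.1 1 0 : ℤ) : ZMod N) = 0 := by
      simpa using castDown (N := N) (M := M) (y := 0) (by simpa using hb3)
    refine ⟨?_, ?_, ?_, ?_⟩
    · rw [hmul 0 0]; push_cast
      rw [ha1, ha2, hb1, hb3N]; ring
    · rw [hmul 0 1]; push_cast
      rw [ha1, ha2, hb2]; ring
    · rw [hmul 1 0]; push_cast
      rw [ha3, ha4, hb3]; ring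
    · rw [hmul 1 1]; push_cast
      rw [ha3, ha4, hb4]; ring
  inv_mem' := by
    rintro a ⟨ha1, ha2, ha3, ha4⟩
    -- first: `a ≡ 1 (mod MN)` automatically
    have hdet : ((a.1 0 0 * a.1 1 1 - a.1 0 1 * a.1 1 0 : ℤ) : ZMod (M*N)) = 1 := by
      rw [← Matrix.det_fin_two]
      simp [a.2]
    have ha1MN : ((a.1 0 0 : ℤ) : ZMod (M*N)) = 1 := by
      push_cast at hdet
      rw [ha3, ha4] at hdet
      simpa using hdet
    have hd : ((a.1 1 1 : ℤ) : ZMod N) = 1 := by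
      have h4' : ((a.1 1 1 : ℤ) : ZMod (M*N)) = ((1 : ℤ) : ZMod (M*N)) := by
        push_cast; exact ha4
      have := castDown (N := N) (M := M) h4'
      push_cast at this; exact this
    have hinv := Matrix.SpecialLinearGroup.SL2_inv_expl a
    refine ⟨?_, ?_, ?_, ?_⟩ <;>
      rw [hinv] <;>
      simp only [Matrix.cons_val_zero, Matrix.cons_val_one, Matrix.head_cons,
        Matrix.head_fin_const, Int.cast_neg, neg_eq_zero]
    · exact hd
    · exact ha2
    · exact ha3
    · exact ha1MN

/-- A point of `ℙ¹(ℚ)`, represented by a coprime pair of integers. -/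
def CuspPt : Type := {v : Fin 2 → ℤ // IsCoprime (v 0) (v 1)}

/-- Two points of `ℙ¹(ℚ)` lie in the same orbit of the Möbius action of
`Γ(N, MN)`: the representing coprime integer vectors differ by the linear
action of an element of `Γ(N, MN)`, up to sign. -/
def cuspRel (N M : ℕ) (p q : CuspPt) : Prop :=
  ∃ γ ∈ GammaNM N M, ∃ ε : ℤˣ, q.1 = (ε : ℤ) • (γ.1.mulVec p.1)

theorem cuspRel_equivalence (N M : ℕ) : Equivalence (cuspRel N M) := by
  constructor
  · intro p
    refine ⟨1, one_mem _, 1, ?_⟩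
    simp [Matrix.SpecialLinearGroup.coe_one, Matrix.one_mulVec]
  · rintro p q ⟨γ, hγ, ε, hq⟩
    refine ⟨γ⁻¹, inv_mem hγ, ε⁻¹, ?_⟩
    rw [hq, Matrix.mulVec_smul, Matrix.mulVec_mulVec, ← Matrix.SpecialLinearGroup.coe_mul,
      inv_mul_cancel, Matrix.SpecialLinearGroup.coe_one, Matrix.one_mulVec, smul_smul,
      Units.inv_mul, one_smul]
  · rintro p q r ⟨γ₁, hγ₁, ε₁, hq⟩ ⟨γ₂, hγ₂, ε₂, hr⟩
    refine ⟨γ₂ * γ₁, mul_mem hγ₂ hγ₁, ε₂ * ε₁, ?_⟩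
    rw [hr, hq, Matrix.mulVec_smul, Matrix.mulVec_mulVec, ← Matrix.SpecialLinearGroup.coe_mul,
      smul_smul, Units.val_mul]

/-- The set `ℙ¹(ℚ)/Γ(N, MN)` of cusps of `Γ(N, MN)`. -/
def cuspSetoid (N M : ℕ) : Setoid CuspPt := ⟨cuspRel N M, cuspRel_equivalence N M⟩

/-- The set of cusps of `Γ(N, MN)`. -/
def Cusps (N M : ℕ) : Type := Quotient (cuspSetoid N M)

/-- Two primitive integer vectors that are congruent modulo `n` differ by the action of a matrix
in `Γ(n)`. -/
lemma exists_mem_Gamma_mulVec_eq (n : ℕ) (v w : Fin 2 → ℤ) (hv : IsCoprime (v 0) (v 1))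
    (hw : IsCoprime (w 0) (w 1)) (h0 : (w 0 : ZMod n) = v 0) (h1 : (w 1 : ZMod n) = v 1) :
    ∃ δ ∈ CongruenceSubgroup.Gamma n, δ.1.mulVec v = w := by
  obtain ⟨l, m, hlm⟩ := hv
  obtain ⟨l', m', hlm'⟩ := hw
  set s : ℤ := m * l' - l * m' with hs
  set x : ℤ := -m' - s * w 0 with hx
  set y : ℤ := l' - s * w 1 with hy
  have hlm_mod := congrArg (Int.cast : ℤ → ZMod n) hlm
  have hlm'_mod := congrArg (Int.cast : ℤ → ZMod n) hlm'
  push_cast at hlm_mod hlm'_mod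
  rw [h0, h1] at hlm'_mod
  have hx_mod : (x : ZMod n) = -m := by
    rw [hx, hs]; push_cast; rw [h0]
    linear_combination (m' : ZMod n) * hlm_mod - m * hlm'_mod
  have hy_mod : (y : ZMod n) = l := by
    rw [hy, hs]; push_cast; rw [h1]
    linear_combination -(l' : ZMod n) * hlm_mod + l * hlm'_mod
  refine ⟨⟨!![w 0 * l - x * v 1, w 0 * m + x * v 0; w 1 * l - y * v 1, w 1 * m + y * v 0], ?_⟩,
    ?_, ?_⟩
  · rw [det_fin_two_of]
    linear_combination (w 0 * y - x * w 1) * hlm + hlm'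
  · refine CongruenceSubgroup.Gamma_mem.2 ?_
    simp only [of_apply, cons_val', cons_val_zero, cons_val_one, cons_val_fin_one]
    push_cast
    rw [h0, h1, hx_mod, hy_mod]
    refine ⟨?_, ?_, ?_, ?_⟩
    · linear_combination hlm_mod
    · ring
    · ring
    · linear_combination hlm_mod
  · ext i
    fin_cases i
    · simp [mulVec, dotProduct, Fin.sum_univ_two]
      linear_combination w 0 * hlm
    · simp [mulVec, dotProduct, Fin.sum_univ_two]
      linear_combination w 1 * hlm

lemma Gamma_le_GammaNM (N M : ℕ) : CongruenceSubgroup.Gamma (M * N) ≤ GammaNM N M := by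
  intro γ hγ
  obtain ⟨h00, h01, h10, h11⟩ := CongruenceSubgroup.Gamma_mem.1 hγ
  refine ⟨?_, ?_, h10, h11⟩
  · simpa using castDown (N := N) (M := M) (x := γ.1 0 0) (y := 1) (by simpa using h00)
  · simpa using castDown (N := N) (M := M) (x := γ.1 0 1) (y := 0) (by simpa using h01)

lemma exists_mem_GammaNM_mulVec_eq_shift (N M : ℕ) (j : ℤ) :
    ∃ τ ∈ GammaNM N M, ∀ v : Fin 2 → ℤ, τ.1.mulVec v = ![v 0 + N * j * v 1, v 1] := by
  refine ⟨⟨!![1, N * j; 0, 1], by simp⟩, ⟨?_, ?_, ?_, ?_⟩, fun v ↦ ?_⟩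
  · simp
  · simp
  · simp
  · simp
  · ext i
    fin_cases i <;> simp [mulVec, dotProduct, Fin.sum_univ_two]

theorem statement_11 (M : ℕ) (hM : 1 ≤ M) (p q : CuspPt) :
    cuspRel 2 M p q ↔
      ∃ (j : ℤ) (ε : ℤˣ),
        q.1 0 ≡ (ε : ℤ) * (p.1 0 + 2*j*(p.1 1)) [ZMOD (2*M : ℕ)] ∧
        q.1 1 ≡ (ε : ℤ) * (p.1 1) [ZMOD (2*M : ℕ)] := by
  rw [mul_comm 2 M]
  simp only [← ZMod.intCast_eq_intCast_iff]
  constructor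
  · rintro ⟨γ, ⟨-, h01, h10, h11⟩, ε, hq⟩
    obtain ⟨j, hj⟩ : ((2 : ℕ) : ℤ) ∣ γ.1 0 1 := (ZMod.intCast_zmod_eq_zero_iff_dvd _ 2).1 h01
    have hdet := congrArg (Int.cast : ℤ → ZMod (M * 2)) ((det_fin_two γ.1).symm.trans γ.2)
    push_cast at hdet
    rw [h10, h11] at hdet
    have h00 : ((γ.1 0 0 : ℤ) : ZMod (M * 2)) = 1 := by simpa using hdet
    refine ⟨j, ε, ?_, ?_⟩
    · rw [hq]
      simp only [Pi.smul_apply, mulVec, dotProduct, Fin.sum_univ_two, smul_eq_mul, hj]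
      push_cast
      rw [h00]; ring
    · rw [hq]
      simp only [Pi.smul_apply, mulVec, dotProduct, Fin.sum_univ_two, smul_eq_mul]
      push_cast
      rw [h10, h11]; ring
  · rintro ⟨j, ε, h0, h1⟩
    have hε : (ε : ℤ) * ε = 1 := by simp [← Units.val_mul]
    have hε_mod := congrArg (Int.cast : ℤ → ZMod (M * 2)) hε
    push_cast at hε_mod h0 h1
    obtain ⟨δ, hδ, hδv⟩ := exists_mem_Gamma_mulVec_eq (M * 2)
      ![p.1 0 + 2 * j * p.1 1, p.1 1] ((ε : ℤ) • q.1)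
      (by simpa using p.2.add_mul_right_left (2 * j))
      (by
        obtain ⟨a, b, hab⟩ := q.2
        refine ⟨a * ε, b * ε, ?_⟩
        simp only [Pi.smul_apply, smul_eq_mul]
        linear_combination (a * q.1 0 + b * q.1 1) * hε + hab)
      (by
        simp
        rw [h0]
        linear_combination (p.1 0 + 2 * j * p.1 1 : ZMod (M * 2)) * hε_mod)
      (by
        simp
        rw [h1]
        linear_combination (p.1 1 : ZMod (M * 2)) * hε_mod)
    obtain ⟨τ, hτ, hτv⟩ := exists_mem_GammaNM_mulVec_eq_shift 2 M j
    refine ⟨δ * τ, mul_mem (Gamma_le_GammaNM 2 M hδ) hτ, ε, ?_⟩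
    change q.1 = (ε : ℤ) • (δ.1 * τ.1).mulVec p.1
    rw [← mulVec_mulVec, hτv, Nat.cast_ofNat, hδv, smul_smul, hε,
      one_smul]
end

section
/- Let M > 2 be an integer. The number of orbits of the Möbius action of Γ(2, 2M) on ℙ¹(ℚ) (cusps of Γ(2,2M)) that are preserved by the involution of ℙ¹(ℚ) sending a/c to −a/c equals 2φ(M) + φ(2M), where φ is Euler's totient function. -/
open Matrix

/-- The involution of `ℙ¹(ℚ)` sending `a/c` to `-a/c` (induced by the
anti-holomorphic involution `τ ↦ -τ̄` of the upper half-plane). -/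
def negCuspPt (p : CuspPt) : CuspPt :=
  ⟨![-(p.1 0), p.1 1], by simpa using p.2.neg_left⟩

lemma mem_GammaNM_iff {N M : ℕ} {γ : Matrix.SpecialLinearGroup (Fin 2) ℤ} :
    γ ∈ GammaNM N M ↔ (N : ℤ) ∣ γ.1 0 0 - 1 ∧ (N : ℤ) ∣ γ.1 0 1 ∧
      (M * N : ℤ) ∣ γ.1 1 0 ∧ (M * N : ℤ) ∣ γ.1 1 1 - 1 := by
  change (_ ∧ _ ∧ _ ∧ _) ↔ _
  have h1 (K : ℕ) (x : ℤ) : ((x : ZMod K) = 1) ↔ (K : ℤ) ∣ x - 1 := by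
    rw [← ZMod.intCast_zmod_eq_zero_iff_dvd]
    push_cast
    rw [sub_eq_zero]
  rw [h1, h1, ZMod.intCast_zmod_eq_zero_iff_dvd, ZMod.intCast_zmod_eq_zero_iff_dvd]
  push_cast
  rfl

/-- The relation `cuspRel`, spelled out in coordinates. -/
lemma cuspRel_iff {N M : ℕ} {p q : CuspPt} :
    cuspRel N M p q ↔ ∃ α β γ δ : ℤ, α * δ - β * γ = 1 ∧ (N : ℤ) ∣ α - 1 ∧ (N : ℤ) ∣ β ∧
      (M * N : ℤ) ∣ γ ∧ (M * N : ℤ) ∣ δ - 1 ∧ ∃ ε : ℤˣ,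
        q.1 0 = ε * (α * p.1 0 + β * p.1 1) ∧ q.1 1 = ε * (γ * p.1 0 + δ * p.1 1) := by
  constructor
  · rintro ⟨g, hg, ε, h⟩
    obtain ⟨h1, h2, h3, h4⟩ := mem_GammaNM_iff.1 hg
    refine ⟨_, _, _, _, ?_, h1, h2, h3, h4, ε, ?_, ?_⟩
    · rw [← Matrix.det_fin_two]
      exact g.2
    · simp [h]
    · simp [h]
  · rintro ⟨α, β, γ, δ, hdet, h1, h2, h3, h4, ε, hq0, hq1⟩
    refine ⟨⟨!![α, β; γ, δ], by rw [Matrix.det_fin_two_of, hdet]⟩, ?_, ε, ?_⟩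
    · exact mem_GammaNM_iff.2 ⟨by simpa using h1, by simpa using h2, by simpa using h3,
        by simpa using h4⟩
    · ext i
      fin_cases i
      · simpa [Matrix.mulVec, dotProduct, Fin.sum_univ_two] using hq0
      · simpa [Matrix.mulVec, dotProduct, Fin.sum_univ_two] using hq1

/-- Primitive vectors congruent modulo `MN` lie in the same orbit. -/
lemma cuspRel_of_dvd_sub {N M : ℕ} {p q : CuspPt} (h0 : (M * N : ℤ) ∣ q.1 0 - p.1 0)
    (h1 : (M * N : ℤ) ∣ q.1 1 - p.1 1) : cuspRel N M p q := by
  obtain ⟨u, w, hp⟩ := p.2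
  obtain ⟨u', w', hq⟩ := q.2
  obtain ⟨r, hr⟩ := h0
  obtain ⟨s, hs⟩ := h1
  rw [cuspRel_iff]
  generalize p.1 0 = a at *
  generalize p.1 1 = c at *
  obtain ha' : q.1 0 = a + M * N * r := by linarith
  obtain hc' : q.1 1 = c + M * N * s := by linarith
  generalize q.1 0 = a' at *
  generalize q.1 1 = c' at *
  obtain ⟨t, ht⟩ : ∃ t, t = w' * u - u' * w := ⟨_, rfl⟩
  obtain ⟨x, hx⟩ : (M * N : ℤ) ∣ -w' + t * a' + w :=
    ⟨w' * (u * r + w * s), by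
      linear_combination a' * ht - w * hq + w' * hp + w' * u * ha' + w' * w * hc'⟩
  obtain ⟨y, hy⟩ : (M * N : ℤ) ∣ u' + t * c' - u :=
    ⟨-u' * (u * r + w * s), by
      linear_combination c' * ht + u * hq - u' * hp - u' * u * ha' - u' * w * hc'⟩
  refine ⟨a' * u - c * (-w' + t * a'), a' * w + a * (-w' + t * a'),
    c' * u - c * (u' + t * c'), c' * w + a * (u' + t * c'), ?_, ?_, ?_, ?_, ?_, 1, ?_, ?_⟩
  · linear_combination (u' * a' + w' * c') * hp + hq
  · have : a' * u - c * (-w' + t * a') - 1 = N * (M * (r * u - c * x)) := by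
      linear_combination u * ha' - c * hx + hp
    exact ⟨_, this⟩
  · have : a' * w + a * (-w' + t * a') = N * (M * (r * w + a * x)) := by
      linear_combination w * ha' + a * hx
    exact ⟨_, this⟩
  · exact ⟨s * u - c * y, by linear_combination u * hc' - c * hy⟩
  · exact ⟨s * w + a * y, by linear_combination w * hc' + a * hy + hp⟩
  · push_cast
    linear_combination (-a') * hp
  · push_cast
    linear_combination (-c') * hp

lemma cuspRel_of_sub_eq {N M : ℕ} {p q : CuspPt} {u v : ℤ}
    (h0 : q.1 0 - p.1 0 = N * (u * p.1 1 + v * M))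
    (h1 : (M * N : ℤ) ∣ q.1 1 - p.1 1) : cuspRel N M p q := by
  have hcop : IsCoprime (p.1 0 + (N * u) * p.1 1) (p.1 1) :=
    IsCoprime.add_mul_right_left p.2 _
  refine (cuspRel_equivalence N M).trans
    (y := ⟨![p.1 0 + (N * u) * p.1 1, p.1 1], by simpa using hcop⟩) ?_
    (cuspRel_of_dvd_sub ⟨v, ?_⟩ (by simpa using h1))
  · exact cuspRel_iff.2
      ⟨1, N * u, 0, 1, by ring, by simp, by simp, by simp, by simp, 1, by simp, by simp⟩
  · simp only [Matrix.cons_val_zero]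
    linear_combination h0

/-- The point of `ℙ¹(ℚ)` represented by the opposite vector. -/
def oppCuspPt (p : CuspPt) : CuspPt :=
  ⟨![-(p.1 0), -(p.1 1)], by simpa using p.2.neg_neg⟩

lemma cuspRel_oppCuspPt (N M : ℕ) (p : CuspPt) : cuspRel N M p (oppCuspPt p) := by
  rw [cuspRel_iff]
  exact ⟨1, 0, 0, 1, by simp, by simp, by simp, by simp, by simp, -1, by simp [oppCuspPt],
    by simp [oppCuspPt]⟩

lemma dvd_of_cuspRel {N M : ℕ} {p q : CuspPt} (h : cuspRel N M p q) :
    ∃ ε : ℤˣ, (M * N : ℤ) ∣ q.1 1 - ε * p.1 1 ∧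
      ∀ d : ℤ, d ∣ M → d ∣ p.1 1 → N * d ∣ q.1 0 - ε * p.1 0 := by
  obtain ⟨α, β, γ, δ, hdet, h1, ⟨b, hb⟩, ⟨g, hg⟩, ⟨e, he⟩, ε, hq0, hq1⟩ := cuspRel_iff.1 h
  refine ⟨ε, ?_, ?_⟩
  · rw [hq1]
    exact ⟨ε * (g * p.1 0 + e * p.1 1), by
      linear_combination (ε : ℤ) * p.1 0 * hg + (ε : ℤ) * p.1 1 * he⟩
  · rintro d ⟨m, hm⟩ ⟨n, hn⟩
    rw [hq0, hn]
    have hα : α - 1 = M * N * (β * g - α * e) := by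
      linear_combination hdet + β * hg - α * he
    exact ⟨ε * (m * (β * g - α * e) * p.1 0 + b * n), by
      linear_combination (ε : ℤ) * p.1 0 * hα + (ε : ℤ) * d * n * hb +
        (ε : ℤ) * p.1 0 * N * (β * g - α * e) * hm⟩

/-- The points of `ℙ¹(ℚ)` whose `Γ(2, 2M)`-orbit is preserved by the involution. -/
def IsSymmCusp (M : ℕ) (p : CuspPt) : Prop := IsCoprime (p.1 1) (M : ℤ) ∨ (M : ℤ) ∣ p.1 1

lemma IsSymmCusp.of_cuspRel {M : ℕ} {p q : CuspPt} (hp : IsSymmCusp M p)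
    (h : cuspRel 2 M p q) : IsSymmCusp M q := by
  obtain ⟨ε, ⟨n, hn⟩, -⟩ := dvd_of_cuspRel h
  have hq : q.1 1 = ε * p.1 1 + M * (2 * n) := by push_cast at hn; linarith
  rw [IsSymmCusp, hq, IsCoprime.add_mul_left_left_iff, Int.dvd_add_left (dvd_mul_right _ _)]
  refine hp.imp (fun hp => ?_) fun hp => hp.mul_left _
  exact (isCoprime_mul_unit_left_left ε.isUnit _ _).2 hp

lemma cuspRel_negCuspPt_iff {M : ℕ} {p : CuspPt} :
    cuspRel 2 M p (negCuspPt p) ↔ IsSymmCusp M p := by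
  constructor
  · intro h
    obtain ⟨ε, hc, ha⟩ := dvd_of_cuspRel h
    simp only [negCuspPt, Matrix.cons_val_zero, Matrix.cons_val_one] at hc ha
    rcases Int.units_eq_one_or ε with rfl | rfl
    · left
      rw [← isRelPrime_iff_isCoprime]
      intro d hd hdM
      obtain ⟨n, hn⟩ := ha d hdM hd
      refine p.2.isUnit_of_dvd' ⟨-n, ?_⟩ hd
      push_cast at hn
      linarith
    · right
      obtain ⟨n, hn⟩ := hc
      refine ⟨n, ?_⟩
      push_cast at hn
      linarith
  · rintro (⟨u, v, huv⟩ | ⟨n, hn⟩)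
    · refine cuspRel_of_sub_eq (u := -p.1 0 * u) (v := -p.1 0 * v) ?_ ?_
      · simp only [negCuspPt, Matrix.cons_val_zero]
        push_cast
        linear_combination (2 * p.1 0) * huv
      · simp [negCuspPt]
    · refine (cuspRel_equivalence 2 M).trans (cuspRel_oppCuspPt 2 M p) (cuspRel_of_dvd_sub ?_ ?_)
      · simp [negCuspPt, oppCuspPt]
      · refine ⟨n, ?_⟩
        simp only [negCuspPt, oppCuspPt, Matrix.cons_val_one]
        push_cast
        linear_combination 2 * hn

/-- Indices for the orbits preserved by the involution. -/
def symmCuspIndex (M : ℕ) : Finset (ℕ × ℕ) :=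
  {z ∈ Finset.range (2 * M) ×ˢ {1, 2} | z.1.Coprime (z.2 * M)}

lemma mem_symmCuspIndex {M x k : ℕ} :
    (x, k) ∈ symmCuspIndex M ↔ x < 2 * M ∧ (k = 1 ∨ k = 2) ∧ x.Coprime k ∧ x.Coprime M := by
  simp [symmCuspIndex, Nat.coprime_mul_iff_right, and_assoc]

lemma card_symmCuspIndex (M : ℕ) :
    (symmCuspIndex M).card = 2 * M.totient + (2 * M).totient := by
  have h : symmCuspIndex M =
      ({x ∈ Finset.range (2 * M) | M.Coprime x} ×ˢ {1}).disjUnion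
        ({x ∈ Finset.range (2 * M) | (2 * M).Coprime x} ×ˢ {2})
        (Finset.disjoint_product.2 (Or.inr (by simp))) := by
    ext ⟨x, k⟩
    simp only [symmCuspIndex, Finset.mem_filter, Finset.mem_product, Finset.mem_disjUnion,
      Finset.mem_insert, Finset.mem_singleton, Nat.coprime_comm (n := x)]
    constructor
    · rintro ⟨⟨hx, rfl | rfl⟩, h⟩
      · exact Or.inl ⟨⟨hx, by simpa using h⟩, rfl⟩
      · exact Or.inr ⟨⟨hx, h⟩, rfl⟩
    · rintro (⟨⟨hx, h⟩, rfl⟩ | ⟨⟨hx, h⟩, rfl⟩)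
      · exact ⟨⟨hx, Or.inl rfl⟩, by simpa using h⟩
      · exact ⟨⟨hx, Or.inr rfl⟩, h⟩
  rw [h, Finset.card_disjUnion, Finset.card_product, Finset.card_product, Finset.card_singleton,
    Finset.card_singleton, mul_one, mul_one, ← Nat.totient_eq_card_coprime]
  congr 1
  rw [Finset.range_eq_Ico, ← Finset.Ico_union_Ico_eq_Ico (Nat.zero_le M) (by omega),
    Finset.filter_union, Finset.card_union_of_disjoint
      (Finset.disjoint_filter_filter (Finset.Ico_disjoint_Ico_consecutive 0 M (2 * M))),
    two_mul M, Nat.filter_coprime_Ico_eq_totient, ← Finset.range_eq_Ico,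
    ← Nat.totient_eq_card_coprime, two_mul]

/-- The representative of the orbit with a given index. -/
def symmCuspPt {M : ℕ} (z : symmCuspIndex M) : CuspPt :=
  ⟨if z.1.1 < M then ![(z.1.2 : ℤ), z.1.1] else ![(z.1.1 : ℤ), z.1.2 * M], by
    obtain ⟨-, -, h1, h2⟩ := mem_symmCuspIndex.1 z.2
    split_ifs
    · simpa using h1.symm.isCoprime
    · simpa using (h1.mul_right h2).isCoprime⟩

lemma symmCuspPt_of_lt {M : ℕ} {z : symmCuspIndex M} (h : z.1.1 < M) :
    (symmCuspPt z).1 0 = z.1.2 ∧ (symmCuspPt z).1 1 = z.1.1 := by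
  simp [symmCuspPt, if_pos h]

lemma symmCuspPt_of_le {M : ℕ} {z : symmCuspIndex M} (h : M ≤ z.1.1) :
    (symmCuspPt z).1 0 = z.1.1 ∧ (symmCuspPt z).1 1 = z.1.2 * M := by
  simp [symmCuspPt, if_neg h.not_gt]

lemma isSymmCusp_symmCuspPt {M : ℕ} (z : symmCuspIndex M) : IsSymmCusp M (symmCuspPt z) := by
  rcases lt_or_ge z.1.1 M with h | h
  · left
    rw [(symmCuspPt_of_lt h).2]
    exact (mem_symmCuspIndex.1 z.2).2.2.2.isCoprime
  · right
    rw [(symmCuspPt_of_le h).2]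
    exact dvd_mul_left _ _

lemma eq_of_dvd_sub_units_mul {M x y : ℕ} {ε : ℤˣ} (hx : x ≠ 0) (hxM : x ≠ M)
    (hx2 : x < 2 * M) (hy2 : y < 2 * M) (hxy : x < M ↔ y < M)
    (h : (M * 2 : ℤ) ∣ y - ε * x) : x = y := by
  rcases Int.units_eq_one_or ε with rfl | rfl
  · have := Int.eq_zero_of_abs_lt_dvd h (by rw [abs_lt]; push_cast; constructor <;> linarith)
    push_cast at this
    omega
  · push_cast at h
    by_cases hlt : x < M
    · have := Int.eq_zero_of_abs_lt_dvd h (by rw [abs_lt]; constructor <;> omega)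
      omega
    · have := Int.eq_zero_of_abs_lt_dvd (dvd_sub_self_right.2 h)
        (by rw [abs_lt]; constructor <;> omega)
      omega

lemma eq_of_two_dvd_sub_units_mul {k l : ℕ} {ε : ℤˣ} (hk : k = 1 ∨ k = 2) (hl : l = 1 ∨ l = 2)
    (h : (2 : ℤ) ∣ l - ε * k) : k = l := by
  rcases Int.units_eq_one_or ε with rfl | rfl <;> push_cast at h <;> omega

lemma not_dvd_of_mem_symmCuspIndex {M x k : ℕ} (hM : 2 < M) (h : (x, k) ∈ symmCuspIndex M) :
    ¬ (M : ℤ) ∣ x := by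
  intro hd
  have := (mem_symmCuspIndex.1 h).2.2.2.symm.eq_one_of_dvd (Int.natCast_dvd_natCast.1 hd)
  omega

lemma symmCuspPt_injective {M : ℕ} (hM : 2 < M) {z w : symmCuspIndex M}
    (h : cuspRel 2 M (symmCuspPt z) (symmCuspPt w)) : z = w := by
  obtain ⟨⟨x, k⟩, hz⟩ := z
  obtain ⟨⟨y, l⟩, hw⟩ := w
  obtain ⟨hx, hk, -, -⟩ := mem_symmCuspIndex.1 hz
  obtain ⟨hy, hl, -, -⟩ := mem_symmCuspIndex.1 hw
  have hxd := not_dvd_of_mem_symmCuspIndex hM hz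
  have hyd := not_dvd_of_mem_symmCuspIndex hM hw
  have hx0 : x ≠ 0 := by rintro rfl; simp at hxd
  have hxM : x ≠ M := by rintro rfl; simp at hxd
  obtain ⟨ε, hc, ha⟩ := dvd_of_cuspRel h
  rcases lt_or_ge x M with hxlt | hxle <;> rcases lt_or_ge y M with hylt | hyle
  · obtain ⟨z0, z1⟩ := symmCuspPt_of_lt (z := ⟨(x, k), hz⟩) hxlt
    obtain ⟨w0, w1⟩ := symmCuspPt_of_lt (z := ⟨(y, l), hw⟩) hylt
    simp only [z0, z1, w0, w1] at hc ha
    have e1 := eq_of_dvd_sub_units_mul hx0 hxM hx hy (by simp [hxlt, hylt]) (by simpa using hc)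
    have e2 := eq_of_two_dvd_sub_units_mul hk hl
      (by simpa using ha 1 (one_dvd _) (one_dvd _))
    simp [e1, e2]
  · obtain ⟨z0, z1⟩ := symmCuspPt_of_lt (z := ⟨(x, k), hz⟩) hxlt
    obtain ⟨w0, w1⟩ := symmCuspPt_of_le (z := ⟨(y, l), hw⟩) hyle
    simp only [z1, w1] at hc
    have := (dvd_sub_right (dvd_mul_left (M : ℤ) l)).1 ((dvd_mul_right (M : ℤ) _).trans hc)
    exact absurd (ε.isUnit.dvd_mul_left.1 this) hxd
  · obtain ⟨z0, z1⟩ := symmCuspPt_of_le (z := ⟨(x, k), hz⟩) hxle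
    obtain ⟨w0, w1⟩ := symmCuspPt_of_lt (z := ⟨(y, l), hw⟩) hylt
    simp only [z1, w1] at hc
    have := (dvd_sub_left ((dvd_mul_left (M : ℤ) k).mul_left (ε : ℤ))).1
      ((dvd_mul_right (M : ℤ) _).trans hc)
    exact absurd this hyd
  · obtain ⟨z0, z1⟩ := symmCuspPt_of_le (z := ⟨(x, k), hz⟩) hxle
    obtain ⟨w0, w1⟩ := symmCuspPt_of_le (z := ⟨(y, l), hw⟩) hyle
    simp only [z0, z1, w0, w1] at hc ha
    have e1 := eq_of_dvd_sub_units_mul (ε := ε) hx0 hxM hx hy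
      (by simp [hxle.not_gt, hyle.not_gt])
      (by simpa [mul_comm] using ha M dvd_rfl (dvd_mul_left _ _))
    have e2 : k = l := by
      refine eq_of_two_dvd_sub_units_mul (ε := ε) hk hl
        (Int.dvd_of_mul_dvd_mul_left (a := M) (by omega) ?_)
      rw [show (M : ℤ) * (l - ε * k) = l * M - ε * (k * M) by ring]
      exact_mod_cast hc
    simp [e1, e2]

lemma exists_lt_dvd_sub_or_dvd_add {M : ℕ} (hM : 0 < M) {c : ℤ} (hc : ¬ (M : ℤ) ∣ c) :
    ∃ x : ℕ, x < M ∧ ((M * 2 : ℤ) ∣ x - c ∨ (M * 2 : ℤ) ∣ x - -c) := by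
  have h0 := Int.emod_nonneg c (b := M * 2) (by omega)
  have h1 := Int.emod_lt_of_pos c (b := M * 2) (by omega)
  have h2 := Int.mul_ediv_add_emod c (M * 2)
  have h3 : c % (M * 2) ≠ M := by
    intro h
    exact hc ⟨2 * (c / (M * 2)) + 1, by linear_combination h - h2⟩
  by_cases h : c % (M * 2) < M
  · refine ⟨(c % (M * 2)).toNat, by omega, Or.inl ⟨-(c / (M * 2)), ?_⟩⟩
    rw [Int.toNat_of_nonneg h0]
    linear_combination h2
  · refine ⟨(M * 2 - c % (M * 2)).toNat, by omega, Or.inr ⟨c / (M * 2) + 1, ?_⟩⟩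
    rw [Int.toNat_of_nonneg (by omega)]
    linear_combination -h2

lemma exists_gt_dvd_sub_or_dvd_add {M : ℕ} (hM : 0 < M) {c : ℤ} (hc : ¬ (M : ℤ) ∣ c) :
    ∃ x : ℕ, M ≤ x ∧ x < 2 * M ∧ ((M * 2 : ℤ) ∣ x - c ∨ (M * 2 : ℤ) ∣ x - -c) := by
  obtain ⟨x, hx, h⟩ := exists_lt_dvd_sub_or_dvd_add hM hc
  have hx0 : x ≠ 0 := by
    rintro rfl
    refine hc ((dvd_mul_right (M : ℤ) 2).trans ?_)
    simpa using h
  refine ⟨2 * M - x, by omega, by omega, h.symm.imp ?_ ?_⟩ <;>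
  · rintro ⟨n, hn⟩
    refine ⟨1 - n, ?_⟩
    push_cast [hx.le.trans (Nat.le_mul_of_pos_left M two_pos)]
    linear_combination -hn

lemma isCoprime_of_dvd_sub {N a b : ℤ} (h : N ∣ b - a) (ha : IsCoprime a N) :
    IsCoprime b N := by
  obtain ⟨n, hn⟩ := h
  rw [show b = a + N * n by linarith]
  exact IsCoprime.add_mul_left_left ha n

lemma not_even_and_even (p : CuspPt) : ¬ (Even (p.1 0) ∧ Even (p.1 1)) := by
  rintro ⟨h0, h1⟩
  have := p.2.isUnit_of_dvd' h0.two_dvd h1.two_dvd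
  exact absurd this (by decide)

lemma exists_two_dvd_sub (a : ℤ) :
    ∃ k : ℕ, (k = 1 ∧ ¬ Even a ∨ k = 2 ∧ Even a) ∧ (2 : ℤ) ∣ k - a := by
  rcases Int.even_or_odd' a with ⟨n, rfl | rfl⟩
  · exact ⟨2, Or.inr ⟨rfl, even_two_mul n⟩, by omega⟩
  · exact ⟨1, Or.inl ⟨rfl, by simp⟩, by omega⟩

lemma exists_cuspRel_of_isCoprime {M x : ℕ} {p : CuspPt} (hp : IsCoprime (p.1 1) (M : ℤ))
    (hx : x < M) (h : (M * 2 : ℤ) ∣ x - p.1 1) :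
    ∃ z : symmCuspIndex M, cuspRel 2 M p (symmCuspPt z) := by
  obtain ⟨k, hk, m, hm⟩ := exists_two_dvd_sub (p.1 0)
  have hxM : x.Coprime M := Nat.isCoprime_iff_coprime.1
    (isCoprime_of_dvd_sub ((dvd_mul_right _ _).trans h) hp)
  have hxk : x.Coprime k := by
    rcases hk with ⟨rfl, -⟩ | ⟨rfl, hev⟩
    · exact Nat.coprime_one_right x
    · have := not_even_and_even p
      rw [Nat.coprime_two_right, ← Nat.not_even_iff_odd]
      intro hxe
      refine this ⟨hev, ?_⟩
      have h2 : Even ((x : ℤ) - p.1 1) :=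
        even_iff_two_dvd.2 ((dvd_mul_left (2 : ℤ) M).trans h)
      exact (Int.even_sub.1 h2).1 (by exact_mod_cast hxe)
  refine ⟨⟨(x, k), mem_symmCuspIndex.2 ⟨by omega, hk.imp And.left And.left, hxk, hxM⟩⟩, ?_⟩
  obtain ⟨z0, z1⟩ := symmCuspPt_of_lt (z := ⟨(x, k), mem_symmCuspIndex.2
    ⟨by omega, hk.imp And.left And.left, hxk, hxM⟩⟩) hx
  obtain ⟨u, v, huv⟩ := hp
  refine cuspRel_of_sub_eq (u := m * u) (v := m * v) ?_ ?_
  · rw [z0]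
    push_cast
    linear_combination hm - 2 * m * huv
  · rw [z1]
    exact_mod_cast h

lemma exists_cuspRel_of_dvd {M x : ℕ} {p : CuspPt} (hp : (M : ℤ) ∣ p.1 1)
    (hx : M ≤ x) (hx2 : x < 2 * M) (h : (M * 2 : ℤ) ∣ x - p.1 0) :
    ∃ z : symmCuspIndex M, cuspRel 2 M p (symmCuspPt z) := by
  have hpM : IsCoprime (p.1 0) (M : ℤ) := p.2.of_isCoprime_of_dvd_right hp
  obtain ⟨n, hn⟩ := hp
  obtain ⟨k, hk, m, hm⟩ := exists_two_dvd_sub n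
  have hxM : x.Coprime M := Nat.isCoprime_iff_coprime.1
    (isCoprime_of_dvd_sub ((dvd_mul_right _ _).trans h) hpM)
  have hxk : x.Coprime k := by
    rcases hk with ⟨rfl, -⟩ | ⟨rfl, hev⟩
    · exact Nat.coprime_one_right x
    · have := not_even_and_even p
      rw [Nat.coprime_two_right, ← Nat.not_even_iff_odd]
      intro hxe
      refine this ⟨?_, hn ▸ hev.mul_left _⟩
      have h2 : Even ((x : ℤ) - p.1 0) :=
        even_iff_two_dvd.2 ((dvd_mul_left (2 : ℤ) M).trans h)
      exact (Int.even_sub.1 h2).1 (by exact_mod_cast hxe)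
  refine ⟨⟨(x, k), mem_symmCuspIndex.2 ⟨hx2, hk.imp And.left And.left, hxk, hxM⟩⟩, ?_⟩
  obtain ⟨z0, z1⟩ := symmCuspPt_of_le (z := ⟨(x, k), mem_symmCuspIndex.2
    ⟨hx2, hk.imp And.left And.left, hxk, hxM⟩⟩) hx
  refine cuspRel_of_dvd_sub ?_ ⟨m, ?_⟩
  · rw [z0]
    exact_mod_cast h
  · rw [z1]
    push_cast
    linear_combination (M : ℤ) * hm - hn

lemma IsSymmCusp.exists_cuspRel {M : ℕ} (hM : 2 < M) {p : CuspPt} (hp : IsSymmCusp M p) :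
    ∃ z : symmCuspIndex M, cuspRel 2 M p (symmCuspPt z) := by
  have hopp : (∃ z : symmCuspIndex M, cuspRel 2 M (oppCuspPt p) (symmCuspPt z)) →
      ∃ z : symmCuspIndex M, cuspRel 2 M p (symmCuspPt z) := fun ⟨z, hz⟩ =>
    ⟨z, (cuspRel_equivalence 2 M).trans (cuspRel_oppCuspPt 2 M p) hz⟩
  have hnot {a : ℤ} (ha : IsCoprime a (M : ℤ)) : ¬ (M : ℤ) ∣ a := by
    intro hd
    have := Int.isUnit_iff_natAbs_eq.1 (ha.isUnit_of_dvd' hd dvd_rfl)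
    rw [Int.natAbs_natCast] at this
    omega
  rcases hp with hp | hp
  · obtain ⟨x, hx, h | h⟩ := exists_lt_dvd_sub_or_dvd_add (by omega) (hnot hp)
    · exact exists_cuspRel_of_isCoprime hp hx h
    · exact hopp (exists_cuspRel_of_isCoprime (p := oppCuspPt p) hp.neg_left hx h)
  · obtain ⟨x, hx, hx2, h | h⟩ := exists_gt_dvd_sub_or_dvd_add (by omega)
      (hnot (p.2.of_isCoprime_of_dvd_right hp))
    · exact exists_cuspRel_of_dvd hp hx hx2 h
    · exact hopp (exists_cuspRel_of_dvd (p := oppCuspPt p) ((dvd_neg (α := ℤ)).2 hp) hx hx2 h)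

lemma preserved_iff_isSymmCusp {M : ℕ} {p : CuspPt} :
    (∀ q : CuspPt, Quotient.mk (cuspSetoid 2 M) q = Quotient.mk (cuspSetoid 2 M) p →
      Quotient.mk (cuspSetoid 2 M) (negCuspPt q) = Quotient.mk (cuspSetoid 2 M) p) ↔
      IsSymmCusp M p := by
  constructor
  · intro h
    exact cuspRel_negCuspPt_iff.1 (Quotient.exact (h p rfl).symm)
  · intro h q hq
    have hqp : cuspRel 2 M q p := Quotient.exact hq
    have hq' := h.of_cuspRel ((cuspRel_equivalence 2 M).symm hqp)
    exact (Quotient.sound (s := cuspSetoid 2 M) (cuspRel_negCuspPt_iff.2 hq')).symm.trans hq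

theorem statement_12 (M : ℕ) (hM : 2 < M) :
    Nat.card {C : Cusps 2 M //
        ∀ p : CuspPt, Quotient.mk (cuspSetoid 2 M) p = C →
          Quotient.mk (cuspSetoid 2 M) (negCuspPt p) = C}
      = 2 * M.totient + (2*M).totient := by
  rw [← card_symmCuspIndex, ← Nat.card_eq_finsetCard]
  refine (Nat.card_congr (Equiv.ofBijective
    (fun z => ⟨Quotient.mk (cuspSetoid 2 M) (symmCuspPt z),
      preserved_iff_isSymmCusp.2 (isSymmCusp_symmCuspPt z)⟩) ⟨?_, ?_⟩)).symm
  · intro z w h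
    exact symmCuspPt_injective hM (Quotient.exact (Subtype.ext_iff.1 h))
  · rintro ⟨C, hC⟩
    induction C using Quotient.inductionOn with
    | h p =>
      obtain ⟨z, hz⟩ := (preserved_iff_isSymmCusp.1 hC).exists_cuspRel hM
      exact ⟨z, Subtype.ext (Quotient.sound (s := cuspSetoid 2 M) hz).symm⟩
end

section
/- Let A be a finite abelian group, n ≥ 2 an integer, and b₁, …, b_{n−1} ∈ A; let B = ℤb₁ + … + ℤb_{n−1} be the subgroup they generate. Let a₁, a₂ ∈ A with a₂ − a₁ ∈ B, and assume ℤa₁ + B = A (equivalently ℤa₂ + B = A). Then in M_n(A) one has ⟨a₁, b₁, …, b_{n−1}⟩ + ⟨−a₁, b₁, …, b_{n−1}⟩ = ⟨a₂, b₁, …, b_{n−1}⟩ + ⟨−a₂, b₁, …, b_{n−1}⟩. -/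
open FreeAbelianGroup AddSubgroup

namespace KPT

variable (n : ℕ) (A : Type) [AddCommGroup A]

/-- Reordering relation (O). -/
def relO : Set (FreeAbelianGroup (GenTuple n A)) :=
  {x | ∃ (β β' : GenTuple n A) (σ : Equiv.Perm (Fin n)),
    β'.1 = β.1 ∘ σ ∧ x = of β - of β'}

/-- Motivic blowup relation (M). -/
def relM : Set (FreeAbelianGroup (GenTuple n A)) :=
  {x | ∃ (hn : 2 ≤ n) (β β₁ β₂ : GenTuple n A),
    β₁.1 = Function.update β.1 ⟨0, by omega⟩
      (β.1 ⟨0, by omega⟩ - β.1 ⟨1, by omega⟩) ∧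
    β₂.1 = Function.update β.1 ⟨1, by omega⟩
      (β.1 ⟨1, by omega⟩ - β.1 ⟨0, by omega⟩) ∧
    x = of β - of β₁ - of β₂}

/-- Anti-symmetry relation (A). -/
def relA : Set (FreeAbelianGroup (GenTuple n A)) :=
  {x | ∃ (hn : 1 ≤ n) (β β' : GenTuple n A),
    β'.1 = Function.update β.1 ⟨0, by omega⟩ (-(β.1 ⟨0, by omega⟩)) ∧
    x = of β + of β'}

/-- The Kontsevich–Pestun–Tschinkel group `M_n(A)`. -/
def Mn : Type :=
  FreeAbelianGroup (GenTuple n A) ⧸ AddSubgroup.closure (relO n A ∪ relM n A)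

instance : AddCommGroup (Mn n A) := QuotientAddGroup.Quotient.addCommGroup _

/-- The group `M_n^-(A)`. -/
def MnMinus : Type :=
  FreeAbelianGroup (GenTuple n A) ⧸
    AddSubgroup.closure (relO n A ∪ relM n A ∪ relA n A)

instance : AddCommGroup (MnMinus n A) := QuotientAddGroup.Quotient.addCommGroup _

/-- The symbol `⟨b₁,…,b_n⟩ ∈ M_n(A)`. -/
def symb (β : GenTuple n A) : Mn n A := QuotientAddGroup.mk (of β)

/-- The symbol `⟨b₁,…,b_n⟩⁻ ∈ M_n⁻(A)`. -/
def symbm (β : GenTuple n A) : MnMinus n A := QuotientAddGroup.mk (of β)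

/-- The natural surjection `M_n(A) → M_n⁻(A)`. -/
def toMinus : Mn n A →+ MnMinus n A :=
  QuotientAddGroup.map _ _ (AddMonoidHom.id _)
    (by
      intro x hx
      simp only [AddSubgroup.mem_comap, AddMonoidHom.id_apply]
      exact AddSubgroup.closure_mono (Set.subset_union_left) hx)

/-- The kernel `K_n(A)` of `M_n(A) → M_n⁻(A)`. -/
def Kn : AddSubgroup (Mn n A) := (toMinus n A).ker

end KPT


namespace KPT

variable {A : Type} [AddCommGroup A] {n : ℕ}

theorem closure_range_update_le {v : Fin n → A} {i : Fin n} {x : A}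
    (hx : x ∈ AddSubgroup.closure (Set.range v)) :
    AddSubgroup.closure (Set.range (Function.update v i x)) ≤
      AddSubgroup.closure (Set.range v) := by
  rw [AddSubgroup.closure_le]
  rintro _ ⟨k, rfl⟩
  rcases eq_or_ne k i with rfl | hk
  · simpa using hx
  · rw [Function.update_of_ne hk]
    exact AddSubgroup.subset_closure ⟨k, rfl⟩

theorem closure_range_update_sub (v : Fin n → A) {i j : Fin n} (hij : i ≠ j) :
    AddSubgroup.closure (Set.range (Function.update v i (v i - v j))) =
      AddSubgroup.closure (Set.range v) := by
  apply le_antisymm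
  · exact closure_range_update_le (sub_mem (AddSubgroup.subset_closure ⟨i, rfl⟩)
      (AddSubgroup.subset_closure ⟨j, rfl⟩))
  · set w := Function.update v i (v i - v j) with hw
    have hv : v = Function.update w i (w i + w j) := by
      simp [hw, hij.symm]
    conv_lhs => rw [hv]
    exact closure_range_update_le (add_mem (AddSubgroup.subset_closure ⟨i, rfl⟩)
      (AddSubgroup.subset_closure ⟨j, rfl⟩))

open Classical in
/-- The symbol of a tuple, extended by zero to the tuples which do not generate `A`. -/
noncomputable def symbOrZero (v : Fin n → A) : Mn n A :=
  if h : AddSubgroup.closure (Set.range v) = ⊤ then symb n A ⟨v, h⟩ else 0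

theorem symbOrZero_of_closure_eq_top {v : Fin n → A}
    (h : AddSubgroup.closure (Set.range v) = ⊤) : symbOrZero v = symb n A ⟨v, h⟩ :=
  dif_pos h

theorem symbOrZero_comp_perm (v : Fin n → A) (σ : Equiv.Perm (Fin n)) :
    symbOrZero (v ∘ σ) = symbOrZero v := by
  have hr : Set.range (v ∘ σ) = Set.range v := σ.surjective.range_comp v
  by_cases h : AddSubgroup.closure (Set.range v) = ⊤
  · have h' : AddSubgroup.closure (Set.range (v ∘ σ)) = ⊤ := by rw [hr, h]
    rw [symbOrZero_of_closure_eq_top h, symbOrZero_of_closure_eq_top h']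
    refine ((QuotientAddGroup.eq_iff_sub_mem).2 ?_).symm
    exact AddSubgroup.subset_closure (Or.inl ⟨_, _, σ, rfl, rfl⟩)
  · rw [symbOrZero, symbOrZero, dif_neg h, dif_neg (by rwa [hr])]

theorem symbOrZero_blowup_zero_one (hn : 2 ≤ n) (v : Fin n → A) :
    symbOrZero v =
      symbOrZero (Function.update v ⟨0, by omega⟩ (v ⟨0, by omega⟩ - v ⟨1, by omega⟩)) +
      symbOrZero (Function.update v ⟨1, by omega⟩ (v ⟨1, by omega⟩ - v ⟨0, by omega⟩)) := by
  have hne : (⟨0, by omega⟩ : Fin n) ≠ ⟨1, by omega⟩ := by simp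
  have e₁ := closure_range_update_sub v hne
  have e₂ := closure_range_update_sub v hne.symm
  by_cases h : AddSubgroup.closure (Set.range v) = ⊤
  · rw [symbOrZero_of_closure_eq_top h, symbOrZero_of_closure_eq_top (e₁.trans h),
      symbOrZero_of_closure_eq_top (e₂.trans h)]
    refine (QuotientAddGroup.eq_iff_sub_mem (y := of _ + of _)).2 ?_
    rw [← sub_sub]
    exact AddSubgroup.subset_closure (Or.inr ⟨hn, _, _, _, rfl, rfl, rfl⟩)
  · rw [symbOrZero, symbOrZero, symbOrZero, dif_neg h, dif_neg (by rwa [e₁]),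
      dif_neg (by rwa [e₂]), add_zero]

/-- Relation (M) at an arbitrary pair of distinct positions. -/
theorem symbOrZero_blowup (v : Fin n → A) {i j : Fin n} (hij : i ≠ j) :
    symbOrZero v = symbOrZero (Function.update v i (v i - v j)) +
      symbOrZero (Function.update v j (v j - v i)) := by
  have hn : 2 ≤ n := by
    by_contra hlt
    exact hij (Fin.ext (by omega))
  obtain ⟨σ, h0, h1⟩ : ∃ σ : Equiv.Perm (Fin n), σ ⟨0, by omega⟩ = i ∧ σ ⟨1, by omega⟩ = j := by
    have hk : Equiv.swap ⟨0, by omega⟩ i (⟨1, by omega⟩ : Fin n) ≠ i := by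
      rw [Ne, Equiv.swap_apply_eq_iff, Equiv.swap_apply_right]
      simp
    refine ⟨Equiv.swap (Equiv.swap ⟨0, by omega⟩ i ⟨1, by omega⟩) j *
      Equiv.swap ⟨0, by omega⟩ i, ?_, ?_⟩
    · rw [Equiv.Perm.mul_apply, Equiv.swap_apply_left, Equiv.swap_apply_of_ne_of_ne hk.symm hij]
    · rw [Equiv.Perm.mul_apply, Equiv.swap_apply_left]
  have key := symbOrZero_blowup_zero_one hn (v ∘ σ)
  simp only [Function.comp_apply, h0, h1] at key
  have hu (k : Fin n) (x : A) :
      Function.update (v ∘ σ) k x = Function.update v (σ k) x ∘ σ :=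
    (Function.update_comp_eq_of_injective v σ.injective k x).symm
  rwa [hu, hu, symbOrZero_comp_perm, symbOrZero_comp_perm, symbOrZero_comp_perm, h0, h1] at key

/-- Translating the first entry by another entry `b i` does not change
`⟨a, b⟩ + ⟨-a, b⟩`. -/
theorem symbOrZero_cons_add_neg_translate (b : Fin n → A) (i : Fin n) (a : A) :
    symbOrZero (Fin.cons (a + b i) b : Fin (n + 1) → A) +
        symbOrZero (Fin.cons (-(a + b i)) b : Fin (n + 1) → A) =
      symbOrZero (Fin.cons a b : Fin (n + 1) → A) +
        symbOrZero (Fin.cons (-a) b : Fin (n + 1) → A) := by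
  let T (x y : A) : Mn (n + 1) A := symbOrZero (Fin.cons x (Function.update b i y))
  have hT (x : A) : symbOrZero (Fin.cons x b : Fin (n + 1) → A) = T x (b i) := by
    simp only [T, Function.update_eq_self]
  have hcomm (x y : A) : T x y = T y x := by
    simp only [T]
    rw [← symbOrZero_comp_perm (Fin.cons y _) (Equiv.swap 0 i.succ)]
    congr 1
    funext k
    refine Fin.cases ?_ (fun k => ?_) k
    · simp
    · rcases eq_or_ne k i with rfl | hk
      · simp [-Fin.cons_update]
      · simp [Equiv.swap_apply_of_ne_of_ne (Fin.succ_ne_zero k)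
          ((Fin.succ_injective n).ne hk), hk]
  have hM (x y : A) : T x y = T (x - y) y + T x (y - x) := by
    have h := symbOrZero_blowup (Fin.cons x (Function.update b i y) : Fin (n + 1) → A)
      (Fin.succ_ne_zero i).symm
    simpa [T, ← Fin.cons_update] using h
  have h₁ := hM (a + b i) (b i)
  simp only [hT]
  rw [add_sub_cancel_right, show b i - (a + b i) = -a by abel] at h₁
  have h₂ := hM (-a) (b i)
  rw [show b i - -a = a + b i by abel, show -a - b i = -(a + b i) by abel] at h₂
  rw [h₁, h₂, hcomm (-a) (a + b i)]
  abel

end KPT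

open KPT in
theorem statement_13 (A : Type) [AddCommGroup A] [Finite A] (m : ℕ) (hm : 1 ≤ m)
    (b : Fin m → A) (a₁ a₂ : A)
    (hmem : a₂ - a₁ ∈ AddSubgroup.closure (Set.range b))
    (h₁ : AddSubgroup.closure (Set.range (Fin.cons a₁ b : Fin (m+1) → A)) = ⊤)
    (h₁' : AddSubgroup.closure (Set.range (Fin.cons (-a₁) b : Fin (m+1) → A)) = ⊤)
    (h₂ : AddSubgroup.closure (Set.range (Fin.cons a₂ b : Fin (m+1) → A)) = ⊤)
    (h₂' : AddSubgroup.closure (Set.range (Fin.cons (-a₂) b : Fin (m+1) → A)) = ⊤) :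
    symb (m+1) A ⟨Fin.cons a₁ b, h₁⟩ + symb (m+1) A ⟨Fin.cons (-a₁) b, h₁'⟩ =
      symb (m+1) A ⟨Fin.cons a₂ b, h₂⟩ + symb (m+1) A ⟨Fin.cons (-a₂) b, h₂'⟩ := by
  rw [← symbOrZero_of_closure_eq_top h₁, ← symbOrZero_of_closure_eq_top h₁',
    ← symbOrZero_of_closure_eq_top h₂, ← symbOrZero_of_closure_eq_top h₂']
  suffices H : ∀ x ∈ AddSubgroup.closure (Set.range b), ∀ a : A,
      symbOrZero (Fin.cons (a + x) b : Fin (m + 1) → A) +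
          symbOrZero (Fin.cons (-(a + x)) b : Fin (m + 1) → A) =
        symbOrZero (Fin.cons a b : Fin (m + 1) → A) +
          symbOrZero (Fin.cons (-a) b : Fin (m + 1) → A) by
    simpa using (H _ hmem a₁).symm
  intro x hx
  induction hx using AddSubgroup.closure_induction with
  | mem x hx =>
    obtain ⟨i, rfl⟩ := hx
    exact symbOrZero_cons_add_neg_translate b i
  | zero => simp
  | add x y _ _ ihx ihy =>
    intro a
    rw [← add_assoc, ihy, ihx]
  | neg x _ ih =>
    intro a
    simpa using (ih (a + -x)).symm
end

section
/- Let A be a finite abelian group, n ≥ 2 an integer, and (a₁, …, a_n) an n-tuple of elements of A with ℤa₁ + … + ℤa_n = A. Then in M_n(A) ⊗ ℚ one has ∑_{ε₁, ε₂ ∈ {±1}} ⟨ε₁a₁, ε₂a₂, a₃, …, a_n⟩ = 0, i.e., ⟨a₁,a₂,a₃,…,a_n⟩ + ⟨−a₁,a₂,a₃,…,a_n⟩ + ⟨a₁,−a₂,a₃,…,a_n⟩ + ⟨−a₁,−a₂,a₃,…,a_n⟩ = 0. -/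
open FreeAbelianGroup AddSubgroup

/-- The sum of a function of two variables over all sign changes of its arguments. -/
def signSum {A V : Type*} [AddCommGroup A] [AddCommGroup V] (f : A → A → V) (a b : A) : V :=
  f a b + f (-a) b + f a (-b) + f (-a) (-b)

section signSum

variable {A V : Type*} [AddCommGroup A] [AddCommGroup V] {f : A → A → V}

theorem signSum_neg_left (a b : A) : signSum f (-a) b = signSum f a b := by
  simp only [signSum, neg_neg]; abel

theorem signSum_neg_right (a b : A) : signSum f a (-b) = signSum f a b := by
  simp only [signSum, neg_neg]; abel

theorem signSum_comm (hs : ∀ a b, f a b = f b a) (a b : A) :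
    signSum f a b = signSum f b a := by
  simp only [signSum]
  rw [hs a b, hs (-a) b, hs a (-b), hs (-a) (-b)]; abel

theorem signSum_sub_right (hs : ∀ a b, f a b = f b a)
    (hb : ∀ a b, f a b = f (a - b) b + f a (b - a)) (a b : A) :
    signSum f a (b - a) = signSum f a b := by
  have key : ∀ s y, f s y + f s (-y) = f s (s - y) + f s (y - s) := fun s y ↦ by
    have h₁ := hb s y
    have h₂ := hb s (s - y)
    rw [sub_sub_cancel, sub_sub_cancel_left, hs y] at h₂
    rw [h₁, h₂]; abel
  have h₁ := key a b
  have h₂ := key (-a) (-b)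
  rw [neg_neg, show -a - -b = b - a by abel, show -b - -a = a - b by abel] at h₂
  calc signSum f a (b - a)
      = (f a (a - b) + f a (b - a)) + (f (-a) (b - a) + f (-a) (a - b)) := by
        simp only [signSum, neg_sub]; abel
    _ = signSum f a b := by rw [← h₁, ← h₂, signSum]; abel

theorem signSum_sub_left (hs : ∀ a b, f a b = f b a)
    (hb : ∀ a b, f a b = f (a - b) b + f a (b - a)) (a b : A) :
    signSum f (a - b) b = signSum f a b := by
  rw [signSum_comm hs, signSum_sub_right hs hb, signSum_comm hs]

/-- A symmetric function on pairs satisfying the blowup relation has vanishing sign sums: these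
are invariant under the invertible substitutions `(a, b) ↦ (a - b, b)` and `(a, b) ↦ (a, b - a)`,
while the blowup relation makes the sum of `f` over a level set of `signSum f` vanish. -/
theorem signSum_eq_zero [Finite A] [IsAddTorsionFree V] (hs : ∀ a b, f a b = f b a)
    (hb : ∀ a b, f a b = f (a - b) b + f a (b - a)) (a b : A) : signSum f a b = 0 := by
  classical
  have := Fintype.ofFinite A
  let S : Finset (A × A) := {p | signSum f p.1 p.2 = signSum f a b}
  have sum_comp : ∀ g : A × A → A × A, Function.Injective g →
      (∀ p, signSum f (g p).1 (g p).2 = signSum f p.1 p.2) →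
      ∑ p ∈ S, f (g p).1 (g p).2 = ∑ p ∈ S, f p.1 p.2 := fun g hg hF ↦
    Finset.sum_equiv (Equiv.ofBijective g (Finite.injective_iff_bijective.1 hg))
      (fun p ↦ by simp [S, hF]) (fun _ _ ↦ rfl)
  have h_left := sum_comp (fun p ↦ (p.1 - p.2, p.2))
    (fun p q h ↦ by
      obtain ⟨h₁, h₂⟩ := Prod.ext_iff.1 h
      exact Prod.ext (by simpa [show p.2 = q.2 from h₂] using h₁) h₂)
    (fun p ↦ signSum_sub_left hs hb p.1 p.2)
  have h_right := sum_comp (fun p ↦ (p.1, p.2 - p.1))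
    (fun p q h ↦ by
      obtain ⟨h₁, h₂⟩ := Prod.ext_iff.1 h
      exact Prod.ext h₁ (by simpa [show p.1 = q.1 from h₁] using h₂))
    (fun p ↦ signSum_sub_right hs hb p.1 p.2)
  have h_zero : ∑ p ∈ S, f p.1 p.2 = 0 := by
    have h : ∑ p ∈ S, f p.1 p.2 = ∑ p ∈ S, f p.1 p.2 + ∑ p ∈ S, f p.1 p.2 := by
      refine Eq.trans ?_ (congrArg₂ (· + ·) h_left h_right)
      rw [← Finset.sum_add_distrib]
      exact Finset.sum_congr rfl fun p _ ↦ hb p.1 p.2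
    exact left_eq_add.1 h
  have h_neg₁ := sum_comp (fun p ↦ (-p.1, p.2))
    (fun p q h ↦ by simpa [Prod.ext_iff] using h) (fun p ↦ signSum_neg_left p.1 p.2)
  have h_neg₂ := sum_comp (fun p ↦ (p.1, -p.2))
    (fun p q h ↦ by simpa [Prod.ext_iff] using h) (fun p ↦ signSum_neg_right p.1 p.2)
  have h_neg₃ := sum_comp (fun p ↦ (-p.1, -p.2))
    (fun p q h ↦ by simpa [Prod.ext_iff] using h)
    (fun p ↦ by rw [signSum_neg_left, signSum_neg_right])
  have h_card : S.card • signSum f a b = 0 := by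
    rw [← Finset.sum_const]
    calc ∑ _p ∈ S, signSum f a b = ∑ p ∈ S, signSum f p.1 p.2 :=
          Finset.sum_congr rfl fun p hp ↦ by simpa [S] using (Finset.mem_filter.1 hp).2.symm
      _ = 0 := by
          simp only [signSum, Finset.sum_add_distrib]
          rw [h_neg₁, h_neg₂, h_neg₃, h_zero]; simp
  refine (nsmul_eq_zero_iff_right (Finset.card_ne_zero_of_mem (a := (a, b)) ?_)).1 h_card
  simp [S]

end signSum

section GenTuple

variable {A : Type} [AddCommGroup A] {m : ℕ}

theorem closure_range_cons_cons_eq_top_of_mem {rest : Fin m → A} {a b a' b' : A}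
    (h : AddSubgroup.closure (Set.range (Fin.cons a (Fin.cons b rest) : Fin (m+2) → A)) = ⊤)
    (ha : a ∈ AddSubgroup.closure ({a', b'} : Set A))
    (hb : b ∈ AddSubgroup.closure ({a', b'} : Set A)) :
    AddSubgroup.closure
      (Set.range (Fin.cons a' (Fin.cons b' rest) : Fin (m+2) → A)) = ⊤ := by
  rw [eq_top_iff, ← h, AddSubgroup.closure_le]
  simp only [Fin.range_cons]
  have hsub : AddSubgroup.closure ({a', b'} : Set A) ≤
      AddSubgroup.closure (insert a' (insert b' (Set.range rest))) :=
    AddSubgroup.closure_mono (by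
      rintro x (rfl | rfl)
      · exact Set.mem_insert _ _
      · exact Set.mem_insert_of_mem _ (Set.mem_insert _ _))
  rintro x (rfl | rfl | hx)
  · exact hsub ha
  · exact hsub hb
  · exact AddSubgroup.subset_closure (Set.mem_insert_of_mem _ (Set.mem_insert_of_mem _ hx))

theorem closure_range_cons_cons_swap {rest : Fin m → A} {a b : A}
    (h : AddSubgroup.closure (Set.range (Fin.cons a (Fin.cons b rest) : Fin (m+2) → A)) = ⊤) :
    AddSubgroup.closure (Set.range (Fin.cons b (Fin.cons a rest) : Fin (m+2) → A)) = ⊤ :=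
  closure_range_cons_cons_eq_top_of_mem h (AddSubgroup.subset_closure (by simp))
    (AddSubgroup.subset_closure (by simp))

theorem closure_range_cons_cons_sub_left_iff {rest : Fin m → A} {a b : A} :
    AddSubgroup.closure
      (Set.range (Fin.cons (a - b) (Fin.cons b rest) : Fin (m+2) → A)) = ⊤ ↔
    AddSubgroup.closure (Set.range (Fin.cons a (Fin.cons b rest) : Fin (m+2) → A)) = ⊤ := by
  refine ⟨fun h ↦ closure_range_cons_cons_eq_top_of_mem h
      (sub_mem (AddSubgroup.subset_closure (by simp)) (AddSubgroup.subset_closure (by simp)))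
      (AddSubgroup.subset_closure (by simp)),
    fun h ↦ closure_range_cons_cons_eq_top_of_mem h ?_ (AddSubgroup.subset_closure (by simp))⟩
  rw [← sub_add_cancel a b]
  exact add_mem (AddSubgroup.subset_closure (by simp)) (AddSubgroup.subset_closure (by simp))

theorem closure_range_cons_cons_sub_right_iff {rest : Fin m → A} {a b : A} :
    AddSubgroup.closure
      (Set.range (Fin.cons a (Fin.cons (b - a) rest) : Fin (m+2) → A)) = ⊤ ↔
    AddSubgroup.closure (Set.range (Fin.cons a (Fin.cons b rest) : Fin (m+2) → A)) = ⊤ :=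
  ⟨fun h ↦ closure_range_cons_cons_swap
      (closure_range_cons_cons_sub_left_iff.1 (closure_range_cons_cons_swap h)),
    fun h ↦ closure_range_cons_cons_swap
      (closure_range_cons_cons_sub_left_iff.2 (closure_range_cons_cons_swap h))⟩

end GenTuple

namespace KPT

section symb

variable {A : Type} [AddCommGroup A] {m : ℕ}

theorem symb_eq_of_perm {n : ℕ} {β β' : GenTuple n A} (σ : Equiv.Perm (Fin n))
    (h : β'.1 = β.1 ∘ σ) : symb n A β = symb n A β' := by
  refine (QuotientAddGroup.eq_iff_sub_mem).2 (AddSubgroup.subset_closure (Or.inl ?_))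
  exact ⟨β, β', σ, h, rfl⟩

theorem symb_cons_cons_swap {rest : Fin m → A} {a b : A}
    (h : AddSubgroup.closure (Set.range (Fin.cons a (Fin.cons b rest) : Fin (m+2) → A)) = ⊤)
    (h' : AddSubgroup.closure (Set.range (Fin.cons b (Fin.cons a rest) : Fin (m+2) → A)) = ⊤) :
    symb (m+2) A ⟨_, h⟩ = symb (m+2) A ⟨_, h'⟩ := by
  refine symb_eq_of_perm (Equiv.swap 0 1) (funext fun i ↦ ?_)
  refine Fin.cases ?_ (fun j ↦ Fin.cases ?_ (fun k ↦ ?_) j) i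
  · rw [Function.comp_apply, Equiv.swap_apply_left]; rfl
  · rw [Function.comp_apply, Fin.succ_zero_eq_one, Equiv.swap_apply_right]; rfl
  · have h₁ : (k.succ.succ : Fin (m+2)) ≠ 1 := by simp [Fin.ext_iff]
    simp [Equiv.swap_apply_of_ne_of_ne (Fin.succ_ne_zero _) h₁]

theorem symb_cons_cons_blowup {rest : Fin m → A} {a b : A}
    (h : AddSubgroup.closure (Set.range (Fin.cons a (Fin.cons b rest) : Fin (m+2) → A)) = ⊤)
    (h₁ : AddSubgroup.closure
      (Set.range (Fin.cons (a - b) (Fin.cons b rest) : Fin (m+2) → A)) = ⊤)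
    (h₂ : AddSubgroup.closure
      (Set.range (Fin.cons a (Fin.cons (b - a) rest) : Fin (m+2) → A)) = ⊤) :
    symb (m+2) A ⟨_, h⟩ = symb (m+2) A ⟨_, h₁⟩ + symb (m+2) A ⟨_, h₂⟩ := by
  refine (QuotientAddGroup.eq_iff_sub_mem (y := of _ + of _)).2
    (AddSubgroup.subset_closure (Or.inr ?_))
  refine ⟨by omega, ⟨_, h⟩, ⟨_, h₁⟩, ⟨_, h₂⟩, ?_, ?_, (sub_sub _ _ _).symm⟩
  · funext i
    refine Fin.cases ?_ (fun j ↦ ?_) i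
    · exact (Function.update_self (β := fun _ ↦ A) (0 : Fin (m+2)) (a - b) _).symm
    · exact (Function.update_of_ne (Fin.succ_ne_zero j) _ _).symm
  · funext i
    refine Fin.cases rfl (fun j ↦ Fin.cases ?_ (fun k ↦ ?_) j) i
    · exact (Function.update_self (β := fun _ ↦ A) (1 : Fin (m+2)) (b - a) _).symm
    · refine (Function.update_of_ne ?_ _ _).symm
      simp [Fin.ext_iff]

open TensorProduct in
open scoped Classical in
/-- The rational symbol `⟨a, b, rest⟩` as a function of its first two entries, extended by zero
to the pairs for which the tuple does not generate `A`. -/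
noncomputable def ratSymb (rest : Fin m → A) (a b : A) : ℚ ⊗[ℤ] Mn (m+2) A :=
  if h : AddSubgroup.closure
      (Set.range (Fin.cons a (Fin.cons b rest) : Fin (m+2) → A)) = ⊤ then
    (1 : ℚ) ⊗ₜ[ℤ] symb (m+2) A ⟨Fin.cons a (Fin.cons b rest), h⟩
  else 0

theorem ratSymb_comm (rest : Fin m → A) (a b : A) : ratSymb rest a b = ratSymb rest b a := by
  by_cases h : AddSubgroup.closure
      (Set.range (Fin.cons a (Fin.cons b rest) : Fin (m+2) → A)) = ⊤
  · have h' := closure_range_cons_cons_swap h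
    rw [ratSymb, ratSymb, dif_pos h, dif_pos h', symb_cons_cons_swap h h']
  · rw [ratSymb, ratSymb, dif_neg h, dif_neg fun h' ↦ h (closure_range_cons_cons_swap h')]

theorem ratSymb_blowup (rest : Fin m → A) (a b : A) :
    ratSymb rest a b = ratSymb rest (a - b) b + ratSymb rest a (b - a) := by
  by_cases h : AddSubgroup.closure
      (Set.range (Fin.cons a (Fin.cons b rest) : Fin (m+2) → A)) = ⊤
  · have h₁ := closure_range_cons_cons_sub_left_iff.2 h
    have h₂ := closure_range_cons_cons_sub_right_iff.2 h
    rw [ratSymb, ratSymb, ratSymb, dif_pos h, dif_pos h₁, dif_pos h₂,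
      symb_cons_cons_blowup h h₁ h₂, TensorProduct.tmul_add]
  · rw [ratSymb, ratSymb, ratSymb, dif_neg h,
      dif_neg (mt closure_range_cons_cons_sub_left_iff.1 h),
      dif_neg (mt closure_range_cons_cons_sub_right_iff.1 h), add_zero]

end symb

end KPT

open KPT TensorProduct in
theorem statement_14 (A : Type) [AddCommGroup A] [Finite A] (m : ℕ)
    (a₁ a₂ : A) (rest : Fin m → A)
    (h₁ : AddSubgroup.closure
      (Set.range (Fin.cons a₁ (Fin.cons a₂ rest) : Fin (m+2) → A)) = ⊤)
    (h₂ : AddSubgroup.closure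
      (Set.range (Fin.cons (-a₁) (Fin.cons a₂ rest) : Fin (m+2) → A)) = ⊤)
    (h₃ : AddSubgroup.closure
      (Set.range (Fin.cons a₁ (Fin.cons (-a₂) rest) : Fin (m+2) → A)) = ⊤)
    (h₄ : AddSubgroup.closure
      (Set.range (Fin.cons (-a₁) (Fin.cons (-a₂) rest) : Fin (m+2) → A)) = ⊤) :
    (1 : ℚ) ⊗ₜ[ℤ] symb (m+2) A ⟨Fin.cons a₁ (Fin.cons a₂ rest), h₁⟩
      + (1 : ℚ) ⊗ₜ[ℤ] symb (m+2) A ⟨Fin.cons (-a₁) (Fin.cons a₂ rest), h₂⟩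
      + (1 : ℚ) ⊗ₜ[ℤ] symb (m+2) A ⟨Fin.cons a₁ (Fin.cons (-a₂) rest), h₃⟩
      + (1 : ℚ) ⊗ₜ[ℤ] symb (m+2) A ⟨Fin.cons (-a₁) (Fin.cons (-a₂) rest), h₄⟩
      = (0 : ℚ ⊗[ℤ] Mn (m+2) A) := by
  have : IsAddTorsionFree (ℚ ⊗[ℤ] Mn (m+2) A) := .of_module_rat _
  have key := signSum_eq_zero (ratSymb_comm rest) (ratSymb_blowup rest) a₁ a₂
  rwa [signSum, ratSymb, ratSymb, ratSymb, ratSymb, dif_pos h₁, dif_pos h₂, dif_pos h₃,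
    dif_pos h₄] at key
end

section
/- Let A be a finite abelian group, n ≥ 2 an integer, and let (a₁, …, a_n) be an n-tuple generating A. Set δ(a₁, a₂) := ∑_{ε₁, ε₂ ∈ {±1}} ⟨ε₁a₁, ε₂a₂, a₃, …, a_n⟩ ∈ M_n(A). Then δ is invariant under the action of SL₂(ℤ) on the first two entries: δ(a₂, −a₁) = δ(a₁, a₂) and δ(a₁ + a₂, a₁) = δ(a₁, a₂) in M_n(A); consequently δ((a b; c d)·(a₁, a₂)) = δ(a₁, a₂) for every (a b; c d) ∈ SL₂(ℤ), where (a b; c d)·(a₁,a₂) = (a·a₁ + b·a₂, c·a₁ + d·a₂). -/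
open FreeAbelianGroup AddSubgroup

namespace KPT

variable {A : Type} [AddCommGroup A] {m : ℕ}

/-- The element `δ(a₁, a₂) = ∑_{ε₁,ε₂ = ±1} ⟨ε₁a₁, ε₂a₂, a₃, …, a_n⟩ ∈ M_n(A)`
(here the trailing entries are `rest`, and the four generation proofs are taken
as arguments). -/
def delta (a₁ a₂ : A) (rest : Fin m → A)
    (h₁ : AddSubgroup.closure
      (Set.range (Fin.cons a₁ (Fin.cons a₂ rest) : Fin (m+2) → A)) = ⊤)
    (h₂ : AddSubgroup.closure
      (Set.range (Fin.cons (-a₁) (Fin.cons a₂ rest) : Fin (m+2) → A)) = ⊤)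
    (h₃ : AddSubgroup.closure
      (Set.range (Fin.cons a₁ (Fin.cons (-a₂) rest) : Fin (m+2) → A)) = ⊤)
    (h₄ : AddSubgroup.closure
      (Set.range (Fin.cons (-a₁) (Fin.cons (-a₂) rest) : Fin (m+2) → A)) = ⊤) :
    Mn (m+2) A :=
  symb (m+2) A ⟨Fin.cons a₁ (Fin.cons a₂ rest), h₁⟩
    + symb (m+2) A ⟨Fin.cons (-a₁) (Fin.cons a₂ rest), h₂⟩
    + symb (m+2) A ⟨Fin.cons a₁ (Fin.cons (-a₂) rest), h₃⟩
    + symb (m+2) A ⟨Fin.cons (-a₁) (Fin.cons (-a₂) rest), h₄⟩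

end KPT

namespace KPT

variable {A : Type} [AddCommGroup A] {m : ℕ}

theorem symb_perm {n : ℕ} (β β' : GenTuple n A) (σ : Equiv.Perm (Fin n)) (h : β'.1 = β.1 ∘ σ) :
    symb n A β = symb n A β' := by
  refine (QuotientAddGroup.eq_iff_sub_mem).2 (AddSubgroup.subset_closure (Or.inl ?_))
  exact ⟨β, β', σ, h, rfl⟩

theorem symb_blowup (β β₁ β₂ : GenTuple (m + 2) A)
    (h₁ : β₁.1 = Function.update β.1 0 (β.1 0 - β.1 1))
    (h₂ : β₂.1 = Function.update β.1 1 (β.1 1 - β.1 0)) :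
    symb (m + 2) A β = symb (m + 2) A β₁ + symb (m + 2) A β₂ := by
  have h : (QuotientAddGroup.mk (of β) : Mn (m + 2) A) = QuotientAddGroup.mk (of β₁ + of β₂) := by
    refine (QuotientAddGroup.eq_iff_sub_mem).2 (AddSubgroup.subset_closure (Or.inr ?_))
    exact ⟨by omega, β, β₁, β₂, h₁, h₂, by abel⟩
  exact h

/-- The entries `x`, `y` together with `rest` generate `A`. -/
def Generates (rest : Fin m → A) (x y : A) : Prop :=
  AddSubgroup.closure (Set.range (Fin.cons x (Fin.cons y rest) : Fin (m + 2) → A)) = ⊤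

theorem Generates.of_mem {rest : Fin m → A} {x y x' y' : A} (h : Generates rest x y)
    (hx : x ∈ AddSubgroup.closure {x', y'}) (hy : y ∈ AddSubgroup.closure {x', y'}) :
    Generates rest x' y' := by
  have hle : AddSubgroup.closure {x', y'} ≤ AddSubgroup.closure
      (Set.range (Fin.cons x' (Fin.cons y' rest) : Fin (m + 2) → A)) := by
    apply AddSubgroup.closure_mono
    rintro z (rfl | rfl)
    · exact ⟨0, rfl⟩
    · exact ⟨1, rfl⟩
  unfold Generates at h ⊢
  rw [eq_top_iff, ← h, AddSubgroup.closure_le]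
  rintro _ ⟨i, rfl⟩
  refine Fin.cases (hle hx) (fun i => Fin.cases (hle hy) (fun i => ?_) i) i
  exact AddSubgroup.subset_closure ⟨i.succ.succ, rfl⟩

theorem Generates.swap {rest : Fin m → A} {x y : A} (h : Generates rest x y) :
    Generates rest y x :=
  h.of_mem (AddSubgroup.subset_closure (by simp)) (AddSubgroup.subset_closure (by simp))

theorem generates_sub_left {rest : Fin m → A} {x y : A} :
    Generates rest (x - y) y ↔ Generates rest x y := by
  constructor <;> intro h <;> refine h.of_mem ?_ (AddSubgroup.subset_closure (by simp))
  · exact sub_mem (AddSubgroup.subset_closure (by simp)) (AddSubgroup.subset_closure (by simp))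
  · rw [← sub_add_cancel x y]
    exact add_mem (AddSubgroup.subset_closure (by simp)) (AddSubgroup.subset_closure (by simp))

theorem generates_sub_right {rest : Fin m → A} {x y : A} :
    Generates rest x (y - x) ↔ Generates rest x y :=
  ⟨fun h => (generates_sub_left.1 h.swap).swap, fun h => (generates_sub_left.2 h.swap).swap⟩

open Classical in
/-- The symbol `⟨x, y, rest⟩`, extended by zero to tuples which do not generate. -/
noncomputable def pairSymb (rest : Fin m → A) (x y : A) : Mn (m + 2) A :=
  if h : Generates rest x y then symb (m + 2) A ⟨Fin.cons x (Fin.cons y rest), h⟩ else 0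

theorem pairSymb_swap (rest : Fin m → A) (x y : A) : pairSymb rest x y = pairSymb rest y x := by
  unfold pairSymb
  by_cases h : Generates rest x y
  · rw [dif_pos h, dif_pos h.swap]
    refine symb_perm _ _ (Equiv.swap 0 1) (funext fun i => ?_)
    refine Fin.cases ?_ (fun i => Fin.cases ?_ (fun i => ?_) i) i
    · simp
    · change x = (Fin.cons x (Fin.cons y rest) : Fin (m + 2) → A) (Equiv.swap 0 1 1)
      simp
    · have hi : Equiv.swap (0 : Fin (m + 2)) 1 i.succ.succ = i.succ.succ :=
        Equiv.swap_apply_of_ne_of_ne (Fin.succ_ne_zero _)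
          (fun h => Fin.succ_ne_zero i (Fin.succ_injective _ h))
      exact (congrArg (Fin.cons x (Fin.cons y rest) : Fin (m + 2) → A) hi).symm
  · rw [dif_neg h, dif_neg (fun h' => h h'.swap)]

theorem pairSymb_blowup (rest : Fin m → A) (x y : A) :
    pairSymb rest x y = pairSymb rest (x - y) y + pairSymb rest x (y - x) := by
  unfold pairSymb
  by_cases h : Generates rest x y
  · rw [dif_pos h, dif_pos (generates_sub_left.2 h), dif_pos (generates_sub_right.2 h)]
    apply symb_blowup <;> funext i <;> refine Fin.cases ?_ (fun i => Fin.cases ?_ (fun i => ?_) i) i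
    all_goals rfl
  · rw [dif_neg h, dif_neg (mt generates_sub_left.1 h), dif_neg (mt generates_sub_right.1 h),
      add_zero]

/-- The sum of the symbols `⟨±x, ±y, rest⟩`, extended by zero to tuples which do not generate. -/
noncomputable def signSum (rest : Fin m → A) (x y : A) : Mn (m + 2) A :=
  pairSymb rest x y + pairSymb rest (-x) y + pairSymb rest x (-y) + pairSymb rest (-x) (-y)

theorem delta_eq_signSum (x y : A) (rest : Fin m → A) (h₁ : _) (h₂ : _) (h₃ : _) (h₄ : _) :
    delta x y rest h₁ h₂ h₃ h₄ = signSum rest x y := by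
  have symb_eq {u v : A} (h : Generates rest u v) :
      pairSymb rest u v = symb (m + 2) A ⟨Fin.cons u (Fin.cons v rest), h⟩ := dif_pos h
  rw [signSum, symb_eq h₁, symb_eq h₂, symb_eq h₃, symb_eq h₄]
  rfl

theorem signSum_rotate (rest : Fin m → A) (x y : A) :
    signSum rest y (-x) = signSum rest x y := by
  simp only [signSum, neg_neg, pairSymb_swap rest y, pairSymb_swap rest (-y)]
  abel

theorem signSum_swap (rest : Fin m → A) (x y : A) : signSum rest y x = signSum rest x y := by
  simp only [signSum, pairSymb_swap rest y, pairSymb_swap rest (-y)]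
  abel

theorem signSum_add_self (rest : Fin m → A) (x y : A) :
    signSum rest (x + y) x = signSum rest x y := by
  have e₁ : pairSymb rest (x + y) x = pairSymb rest x y + pairSymb rest (x + y) (-y) := by
    rw [pairSymb_blowup, pairSymb_swap rest x y]
    congr 2 <;> abel
  have e₂ : pairSymb rest (-(x + y)) (-x) =
      pairSymb rest (-x) (-y) + pairSymb rest (-(x + y)) y := by
    rw [pairSymb_blowup, pairSymb_swap rest (-x) (-y)]
    congr 2 <;> abel
  have e₃ : pairSymb rest x (-y) =
      pairSymb rest (x + y) (-y) + pairSymb rest (-(x + y)) x := by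
    rw [pairSymb_blowup, pairSymb_swap rest (-(x + y)) x]
    congr 2 <;> abel
  have e₄ : pairSymb rest (-x) y =
      pairSymb rest (-(x + y)) y + pairSymb rest (x + y) (-x) := by
    rw [pairSymb_blowup, pairSymb_swap rest (x + y) (-x)]
    congr 2 <;> abel
  rw [signSum, signSum, e₁, e₂, e₃, e₄]
  abel

theorem signSum_smul (rest : Fin m → A) (g : Matrix.SpecialLinearGroup (Fin 2) ℤ) (x y : A) :
    signSum rest (g.1 0 0 • x + g.1 0 1 • y) (g.1 1 0 • x + g.1 1 1 • y) = signSum rest x y := by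
  have hg : g ∈ Subgroup.closure {ModularGroup.S, ModularGroup.T} := by
    rw [SpecialLinearGroup.SL2Z_generators]
    exact Subgroup.mem_top g
  induction hg using Subgroup.closure_induction generalizing x y with
  | mem g hg =>
    rcases hg with rfl | rfl
    · simpa [ModularGroup.S] using (signSum_rotate rest (-x) (-y)).trans
        ((signSum_rotate rest y (-x)).trans (signSum_rotate rest x y))
    · simpa [ModularGroup.T, add_comm x y] using
        (signSum_add_self rest y x).trans (signSum_swap rest x y)
  | one => simp
  | mul g h _ _ ihg ihh =>
    rw [← ihh x y, ← ihg (h.1 0 0 • x + h.1 0 1 • y)]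
    simp only [Matrix.SpecialLinearGroup.coe_mul, Matrix.mul_apply, Fin.sum_univ_two]
    congr 1 <;> module
  | inv g _ ih =>
    rw [← ih]
    have h (i j : Fin 2) := congrFun (congrFun (congrArg Subtype.val (mul_inv_cancel g)) i) j
    simp only [Matrix.SpecialLinearGroup.coe_mul, Matrix.mul_apply, Fin.sum_univ_two] at h
    congr 1
    · trans (g.1 0 0 * g⁻¹.1 0 0 + g.1 0 1 * g⁻¹.1 1 0) • x +
        (g.1 0 0 * g⁻¹.1 0 1 + g.1 0 1 * g⁻¹.1 1 1) • y
      · module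
      · rw [h 0 0, h 0 1]; simp
    · trans (g.1 1 0 * g⁻¹.1 0 0 + g.1 1 1 * g⁻¹.1 1 0) • x +
        (g.1 1 0 * g⁻¹.1 0 1 + g.1 1 1 * g⁻¹.1 1 1) • y
      · module
      · rw [h 1 0, h 1 1]; simp

end KPT

open KPT in
theorem statement_15 (A : Type) [AddCommGroup A] [Finite A] (m : ℕ)
    (a₁ a₂ : A) (rest : Fin m → A)
    (h₁ : _) (h₂ : _) (h₃ : _) (h₄ : _)
    (hS₁ : _) (hS₂ : _) (hS₃ : _) (hS₄ : _)
    (hT₁ : _) (hT₂ : _) (hT₃ : _) (hT₄ : _) :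
    -- invariance under S : (a₁, a₂) ↦ (a₂, -a₁)
    delta a₂ (-a₁) rest hS₁ hS₂ hS₃ hS₄ = delta a₁ a₂ rest h₁ h₂ h₃ h₄ ∧
    -- invariance under T : (a₁, a₂) ↦ (a₁ + a₂, a₁)
    delta (a₁ + a₂) a₁ rest hT₁ hT₂ hT₃ hT₄ = delta a₁ a₂ rest h₁ h₂ h₃ h₄ ∧
    -- consequently, invariance under all of SL₂(ℤ)
    ∀ g : Matrix.SpecialLinearGroup (Fin 2) ℤ, ∀ (hg₁ : _) (hg₂ : _) (hg₃ : _) (hg₄ : _),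
      delta (g.1 0 0 • a₁ + g.1 0 1 • a₂) (g.1 1 0 • a₁ + g.1 1 1 • a₂) rest
          hg₁ hg₂ hg₃ hg₄
        = delta a₁ a₂ rest h₁ h₂ h₃ h₄ := by
  simp only [delta_eq_signSum]
  exact ⟨signSum_rotate rest a₁ a₂, signSum_add_self rest a₁ a₂,
    fun g _ _ _ _ => signSum_smul rest g a₁ a₂⟩
end
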